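/- arXiv:math/0405448 — 2 statements merged into one kernel-verified Lean document; each statement's English description precedes it below -/
import Mathlib

section
/- Let P ⊆ ℝ^d be a reflexive polytope, let α be the maximal number of vertices of a facet of P, and let β be the maximal number of facets of a facet of P. Then the number of vertices of P satisfies |V(P)| ≤ (α − d + 1)β + 2 + 2·√((α − 1)(d + 1)((α − 1) + (α − d + 1)β)). In particular, if P is simplicial (so α = d = β), then |V(P)| ≤ d + 2 + 2·√((d² − 1)(2d − 1)). -/
open scoped BigOperators

noncomputable section

/-- The standard dot product on `ℝ^d`. -/
def dotProd {d : ℕ} (x y : Fin d → ℝ) : ℝ := ∑ i, x i * y i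

/-- A point of `ℝ^d` is a lattice point (element of `ℤ^d`) if all coordinates are integers. -/
def IsLatticePoint {d : ℕ} (x : Fin d → ℝ) : Prop := ∀ i, ∃ n : ℤ, x i = (n : ℝ)

/-- A lattice polytope is the convex hull of finitely many lattice points. -/
def IsLatticePolytope {d : ℕ} (P : Set (Fin d → ℝ)) : Prop :=
  ∃ V : Finset (Fin d → ℝ), (∀ v ∈ V, IsLatticePoint v) ∧ P = convexHull ℝ (V : Set (Fin d → ℝ))

/-- The dual polytope `P* = {y | ⟨x,y⟩ ≥ -1 ∀ x ∈ P}`. -/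
def dualPolytope {d : ℕ} (P : Set (Fin d → ℝ)) : Set (Fin d → ℝ) :=
  {y | ∀ x ∈ P, -1 ≤ dotProd x y}

/-- A reflexive polytope: a full-dimensional lattice polytope with `0` in its interior whose
dual polytope is again a lattice polytope. -/
def IsReflexive {d : ℕ} (P : Set (Fin d → ℝ)) : Prop :=
  IsLatticePolytope P ∧ (0 : Fin d → ℝ) ∈ interior P ∧ IsLatticePolytope (dualPolytope P)

/-- A face of `P`: the subset of `P` where some linear functional attains its maximum bound. -/
def IsFace {d : ℕ} (P F : Set (Fin d → ℝ)) : Prop :=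
  ∃ (u : Fin d → ℝ) (c : ℝ), (∀ x ∈ P, dotProd u x ≤ c) ∧ F = {x ∈ P | dotProd u x = c}

/-- A facet of a `d`-dimensional polytope: a nonempty face of dimension `d - 1`. -/
def IsFacet {d : ℕ} (P F : Set (Fin d → ℝ)) : Prop :=
  IsFace P F ∧ F.Nonempty ∧ Module.finrank ℝ (vectorSpan ℝ F) = d - 1

/-- `x ∼ y` : `x` and `y` lie in a common facet of `P`. -/
def SameFacet {d : ℕ} (P : Set (Fin d → ℝ)) (x y : Fin d → ℝ) : Prop :=
  ∃ F, IsFacet P F ∧ x ∈ F ∧ y ∈ F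

/-- The star set of `x`: the union of all facets of `P` containing `x`. -/
def starSet {d : ℕ} (P : Set (Fin d → ℝ)) (x : Fin d → ℝ) : Set (Fin d → ℝ) :=
  {y | SameFacet P x y}

/-- A family of lattice points forming a `ℤ`-basis of the lattice `ℤ^d`. -/
def IsZBasisFamily {d n : ℕ} (s : Fin n → (Fin d → ℝ)) : Prop :=
  LinearIndependent ℝ s ∧ (∀ i, IsLatticePoint (s i)) ∧
    ∀ z : Fin d → ℝ, IsLatticePoint z → ∃ c : Fin n → ℤ, z = ∑ i, (c i : ℝ) • s i

/-- A primitive lattice point: a nonzero lattice point such that no lattice point lies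
strictly between `0` and it. -/
def IsPrimitivePoint {d : ℕ} (x : Fin d → ℝ) : Prop :=
  IsLatticePoint x ∧ x ≠ 0 ∧ ∀ y ∈ openSegment ℝ (0 : Fin d → ℝ) x, ¬ IsLatticePoint y

/-- A Fano polytope: a full-dimensional lattice polytope with `0` in its interior all of whose
vertices are primitive lattice points. -/
def IsFanoPolytope {d : ℕ} (P : Set (Fin d → ℝ)) : Prop :=
  IsLatticePolytope P ∧ (0 : Fin d → ℝ) ∈ interior P ∧
    ∀ v ∈ Set.extremePoints ℝ P, IsPrimitivePoint v

/-- Canonical: the only interior lattice point is the origin. -/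
def IsCanonicalPolytope {d : ℕ} (P : Set (Fin d → ℝ)) : Prop :=
  {x ∈ interior P | IsLatticePoint x} = {0}

/-- Terminal: the only lattice points of `P` are the origin and the vertices. -/
def IsTerminalPolytope {d : ℕ} (P : Set (Fin d → ℝ)) : Prop :=
  {x ∈ P | IsLatticePoint x} = insert (0 : Fin d → ℝ) (Set.extremePoints ℝ P)

/-- Simplicial: every facet has exactly `d` vertices. -/
def IsSimplicial {d : ℕ} (P : Set (Fin d → ℝ)) : Prop :=
  ∀ F, IsFacet P F → (Set.extremePoints ℝ F).ncard = d

/-- Smooth: the vertices of every facet form a `ℤ`-basis of the lattice. -/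
def IsSmoothPolytope {d : ℕ} (P : Set (Fin d → ℝ)) : Prop :=
  ∀ F, IsFacet P F → ∃ s : Fin d → (Fin d → ℝ),
    Set.extremePoints ℝ F = Set.range s ∧ IsZBasisFamily s

/-- Semi-terminal: any two distinct vertices in a common facet are joined by a lattice-point
free segment. -/
def IsSemiTerminal {d : ℕ} (P : Set (Fin d → ℝ)) : Prop :=
  ∀ v ∈ Set.extremePoints ℝ P, ∀ w ∈ Set.extremePoints ℝ P, v ≠ w → SameFacet P v w →
    {x ∈ segment ℝ v w | IsLatticePoint x} = {v, w}

/-- The quotient space `ℝ^d / ℝv`. -/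
abbrev QuotSpace {d : ℕ} (v : Fin d → ℝ) := (Fin d → ℝ) ⧸ (Submodule.span ℝ {v})

/-- The canonical projection `π_v : ℝ^d → ℝ^d/ℝv`. -/
def projAlong {d : ℕ} (v : Fin d → ℝ) : (Fin d → ℝ) →ₗ[ℝ] QuotSpace v :=
  (Submodule.span ℝ {v}).mkQ

/-- The quotient lattice `ℤ^d/ℤv`, regarded as the image of `ℤ^d` in `ℝ^d/ℝv`. -/
def quotLattice {d : ℕ} (v : Fin d → ℝ) : Set (QuotSpace v) :=
  projAlong v '' {x | IsLatticePoint x}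

/-- A primitive point of the quotient lattice `ℤ^d/ℤv`. -/
def QuotPrimitive {d : ℕ} (v : Fin d → ℝ) (q : QuotSpace v) : Prop :=
  q ∈ quotLattice v ∧ q ≠ 0 ∧ ∀ t ∈ openSegment ℝ (0 : QuotSpace v) q, t ∉ quotLattice v

/-- A Fano polytope in the quotient space `ℝ^d/ℝv` with respect to the lattice `ℤ^d/ℤv`. -/
def QuotIsFanoPolytope {d : ℕ} (v : Fin d → ℝ) (Q : Set (QuotSpace v)) : Prop :=
  (∃ V : Finset (QuotSpace v), (∀ q ∈ V, q ∈ quotLattice v) ∧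
      Q = convexHull ℝ (V : Set (QuotSpace v))) ∧
  (0 : QuotSpace v) ∈ interior Q ∧
  ∀ q ∈ Set.extremePoints ℝ Q, QuotPrimitive v q

/-- Unimodular equivalence: a real linear isomorphism mapping lattice onto lattice and one
polytope onto the other. -/
def LatticeEquivTo {d e : ℕ} (P : Set (Fin d → ℝ)) (Q : Set (Fin e → ℝ)) : Prop :=
  ∃ f : (Fin d → ℝ) ≃ₗ[ℝ] (Fin e → ℝ),
    (∀ x, IsLatticePoint x ↔ IsLatticePoint (f x)) ∧ f '' P = Q

/-- The hexagon `Z₂ = conv(±(1,0), ±(0,1), ±(1,1)) ⊆ ℝ²`. -/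
def Z2 : Set (Fin 2 → ℝ) :=
  convexHull ℝ ({![1,0], ![0,1], ![1,1], ![-1,0], ![0,-1], ![-1,-1]} : Set (Fin 2 → ℝ))

/-- The `j`-th coordinate pair of a point of `ℝ^{2m}`. -/
def pairCoords {m : ℕ} (x : Fin (2 * m) → ℝ) (j : Fin m) : Fin 2 → ℝ :=
  fun i => x ⟨2 * (j : ℕ) + (i : ℕ), by have := j.isLt; have := i.isLt; omega⟩

/-- The `m`-fold product `Z₂ × ⋯ × Z₂ ⊆ ℝ^{2m}`. -/
def prodZ2 (m : ℕ) : Set (Fin (2 * m) → ℝ) := {x | ∀ j : Fin m, pairCoords x j ∈ Z2}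

/-- The `j`-th coordinate pair of a point of `ℝ^{2m+1}` (first `2m` coordinates). -/
def pairCoords' {m : ℕ} (x : Fin (2 * m + 1) → ℝ) (j : Fin m) : Fin 2 → ℝ :=
  fun i => x ⟨2 * (j : ℕ) + (i : ℕ), by have := j.isLt; have := i.isLt; omega⟩

/-- The product `[-1,1] × Z₂ × ⋯ × Z₂ ⊆ ℝ^{2m+1}` with `m` hexagon factors. -/
def boxProdZ2 (m : ℕ) : Set (Fin (2 * m + 1) → ℝ) :=
  {x | x ⟨2 * m, by omega⟩ ∈ Set.Icc (-1 : ℝ) 1 ∧ ∀ j : Fin m, pairCoords' x j ∈ Z2}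

/-- A facet of the facet `F` of a `d`-dimensional polytope: a nonempty face of `F` of
dimension `d - 2`. -/
def IsFacetOfFacet {d : ℕ} (F G : Set (Fin d → ℝ)) : Prop :=
  IsFace F G ∧ G.Nonempty ∧ Module.finrank ℝ (vectorSpan ℝ G) = d - 2

/-- A subset of a compact convex set cut out by supporting hyperplanes is an extreme subset. -/
lemma isExtreme_dotProduct_eq {d : ℕ} {K T : Set (Fin d → ℝ)} {c : ℝ}
    (h : ∀ y ∈ K, ∀ g ∈ T, c ≤ g ⬝ᵥ y) : IsExtreme ℝ K {y ∈ K | ∀ g ∈ T, g ⬝ᵥ y = c} := by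
  refine ⟨fun y hy ↦ hy.1, fun x hx y hy z hz hzxy ↦ ⟨hx, fun g hg ↦ ?_⟩⟩
  obtain ⟨a, b, ha, hb, hab, rfl⟩ := hzxy
  have hz' := hz.2 g hg
  rw [dotProduct_add, dotProduct_smul, dotProduct_smul, smul_eq_mul, smul_eq_mul] at hz'
  have h1 := h x hx g hg
  have h2 := h y hy g hg
  obtain rfl : b = 1 - a := by linarith
  refine le_antisymm ?_ h1
  by_contra! hlt
  nlinarith [mul_pos ha (sub_pos.2 hlt), mul_nonneg hb.le (sub_nonneg.2 h2)]

lemma isCompact_dotProduct_eq {d : ℕ} {K T : Set (Fin d → ℝ)} {c : ℝ} (hK : IsCompact K) :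
    IsCompact {y ∈ K | ∀ g ∈ T, g ⬝ᵥ y = c} := by
  refine hK.inter_right (?_ : IsClosed {y : Fin d → ℝ | ∀ g ∈ T, g ⬝ᵥ y = c})
  simp only [Set.ofPred_forall]
  exact isClosed_biInter fun g _ ↦ isClosed_eq (by fun_prop) continuous_const

lemma convex_dotProduct_eq {d : ℕ} {K T : Set (Fin d → ℝ)} {c : ℝ} (hK : Convex ℝ K) :
    Convex ℝ {y ∈ K | ∀ g ∈ T, g ⬝ᵥ y = c} := by
  intro x hx y hy a b ha hb hab
  refine ⟨hK hx.1 hy.1 ha hb hab, fun g hg ↦ ?_⟩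
  rw [dotProduct_add, dotProduct_smul, dotProduct_smul, hx.2 g hg, hy.2 g hg, ← add_smul, hab,
    one_smul]

/-- A linear functional on a compact set is minimized at an extreme point. -/
lemma exists_extremePoint_dotProduct_le {d : ℕ} {K : Set (Fin d → ℝ)} (hK : IsCompact K)
    (v : Fin d → ℝ) {x : Fin d → ℝ} (hx : x ∈ K) :
    ∃ y ∈ K.extremePoints ℝ, v ⬝ᵥ y ≤ v ⬝ᵥ x := by
  obtain ⟨m, hm, hmin⟩ := hK.exists_isMinOn ⟨x, hx⟩
    (f := fun y ↦ v ⬝ᵥ y) (by fun_prop : Continuous fun y ↦ v ⬝ᵥ y).continuousOn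
  have hext : IsExtreme ℝ K {y ∈ K | ∀ g ∈ ({v} : Set (Fin d → ℝ)), g ⬝ᵥ y = v ⬝ᵥ m} :=
    isExtreme_dotProduct_eq fun y hy g hg ↦ by
      rw [Set.mem_singleton_iff.1 hg]
      exact hmin hy
  obtain ⟨y, hy⟩ := (isCompact_dotProduct_eq hK).extremePoints_nonempty
    (s := {y ∈ K | ∀ g ∈ ({v} : Set (Fin d → ℝ)), g ⬝ᵥ y = v ⬝ᵥ m}) ⟨m, hm, by simp⟩
  exact ⟨y, hext.extremePoints_subset_extremePoints hy,
    (hy.1.2 v rfl).trans_le (hmin hx)⟩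

/-- No segment inside `K` contains an extreme point of `K` in its relative interior. -/
lemma eq_zero_of_mem_extremePoints {d : ℕ} {K : Set (Fin d → ℝ)} {y z : Fin d → ℝ} {ε ε' : ℝ}
    (hy : y ∈ K.extremePoints ℝ) (hε : 0 < ε) (hε' : 0 < ε') (h : y + ε • z ∈ K)
    (h' : y + ε' • -z ∈ K) : z = 0 := by
  have key := hy.2 h h' ⟨ε' / (ε + ε'), ε / (ε + ε'), by positivity, by positivity,
    by field_simp; ring, by
      ext i
      simp only [Pi.add_apply, Pi.smul_apply, Pi.neg_apply, smul_eq_mul]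
      field_simp
      ring⟩
  simpa [hε.ne'] using key

/-- A direction along which no active constraint decreases can be followed for a while. -/
lemma exists_pos_forall_le_dotProduct_add_smul {d : ℕ} (S : Finset (Fin d → ℝ)) (c : ℝ)
    {y u : Fin d → ℝ} (hy : ∀ g ∈ S, c ≤ g ⬝ᵥ y)
    (hu : ∀ g ∈ S, g ⬝ᵥ y = c → 0 ≤ g ⬝ᵥ u) :
    ∃ ε : ℝ, 0 < ε ∧ ∀ g ∈ S, c ≤ g ⬝ᵥ (y + ε • u) := by
  have h : ∀ᶠ ε in nhdsWithin (0 : ℝ) (Set.Ioi 0), ∀ g ∈ S, c ≤ g ⬝ᵥ (y + ε • u) := by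
    rw [Filter.eventually_all_finset]
    intro g hg
    rcases (hy g hg).eq_or_lt with heq | hlt
    · filter_upwards [self_mem_nhdsWithin] with ε hε
      rw [dotProduct_add, dotProduct_smul, ← heq, smul_eq_mul]
      nlinarith [mul_nonneg (le_of_lt hε) (hu g hg heq.symm)]
    · have hc : Continuous fun ε : ℝ ↦ g ⬝ᵥ (y + ε • u) := by fun_prop
      have := hc.continuousAt.eventually 
        (lt_mem_nhds (by simpa using hlt : c < g ⬝ᵥ (y + (0 : ℝ) • u)))
      exact (this.filter_mono nhdsWithin_le_nhds).mono fun ε h ↦ h.le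
  obtain ⟨ε, h, hε⟩ := (h.and self_mem_nhdsWithin).exists
  exact ⟨ε, hε, h⟩

lemma exists_orthogonal_ne_zero {d : ℕ} {S : Set (Fin d → ℝ)}
    (hS : Submodule.span ℝ S ≠ ⊤) : ∃ z ≠ 0, ∀ g ∈ S, g ⬝ᵥ z = 0 := by
  obtain ⟨f, hf, hle⟩ := Submodule.exists_le_ker_of_lt_top _ hS.lt_top
  refine ⟨(dotProductEquiv ℝ (Fin d)).symm f, by simpa using hf, fun g hg ↦ ?_⟩
  have h := hle (Submodule.subset_span hg)
  rw [LinearMap.mem_ker, ← (dotProductEquiv ℝ (Fin d)).apply_symm_apply f] at h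
  rw [dotProduct_comm]
  exact h

lemma eq_zero_of_span_eq_top {d : ℕ} {S : Set (Fin d → ℝ)} (hS : Submodule.span ℝ S = ⊤)
    {z : Fin d → ℝ} (hz : ∀ g ∈ S, g ⬝ᵥ z = 0) : z = 0 := by
  have h : Submodule.span ℝ S ≤ LinearMap.ker (dotProductEquiv ℝ (Fin d) z) :=
    Submodule.span_le.2 fun g hg ↦ by
      simpa [dotProduct_comm] using hz g hg
  rw [hS, top_le_iff, LinearMap.ker_eq_top] at h
  simpa using h

/-- A vertex of a polyhedron lies on facets whose normals span the whole space. -/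
lemma span_active_eq_top {d : ℕ} {V : Finset (Fin d → ℝ)} {D : Set (Fin d → ℝ)} {c : ℝ}
    (hD : D = {y | ∀ v ∈ V, c ≤ v ⬝ᵥ y}) {w : Fin d → ℝ} (hw : w ∈ D.extremePoints ℝ) :
    Submodule.span ℝ {v | v ∈ V ∧ v ⬝ᵥ w = c} = ⊤ := by
  by_contra hne
  obtain ⟨z, hz, hz0⟩ := exists_orthogonal_ne_zero hne
  subst hD
  obtain ⟨ε, hε, h⟩ := exists_pos_forall_le_dotProduct_add_smul V c hw.1 (u := z)
    fun g hg h ↦ (hz0 g ⟨hg, h⟩).ge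
  obtain ⟨ε', hε', h'⟩ := exists_pos_forall_le_dotProduct_add_smul V c hw.1 (u := -z)
    fun g hg h ↦ by simp [hz0 g ⟨hg, h⟩]
  exact hz (eq_zero_of_mem_extremePoints (ε := ε) (ε' := ε') hw hε hε' h h')

lemma isCompact_of_span_eq_top {d : ℕ} {A : Finset (Fin d → ℝ)}
    (hA : Submodule.span ℝ (A : Set (Fin d → ℝ)) = ⊤) :
    IsCompact {u : Fin d → ℝ | ∀ g ∈ A, g ⬝ᵥ u ∈ Set.Icc (0 : ℝ) 1} := by
  let L : (Fin d → ℝ) →ₗ[ℝ] (A → ℝ) := LinearMap.pi fun g ↦ dotProductEquiv ℝ (Fin d) g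
  have hL : LinearMap.ker L = ⊥ := by
    refine (LinearMap.ker_eq_bot').2 fun z hz ↦ eq_zero_of_span_eq_top hA fun g hg ↦ ?_
    exact congrFun hz ⟨g, hg⟩
  have := (LinearMap.isClosedEmbedding_of_injective hL).isCompact_preimage
    (isCompact_univ_pi fun _ : A ↦ isCompact_Icc (a := (0 : ℝ)) (b := 1))
  convert this using 1
  ext u
  simp only [Set.mem_preimage, Set.mem_univ_pi, Subtype.forall]
  rfl

/-- The extreme rays of a pointed cone detect where a linear functional is negative. -/
lemma exists_extreme_ray {d : ℕ} {A : Finset (Fin d → ℝ)}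
    (hA : Submodule.span ℝ (A : Set (Fin d → ℝ)) = ⊤) {v x : Fin d → ℝ}
    (hx : ∀ g ∈ A, 0 ≤ g ⬝ᵥ x) (hvx : v ⬝ᵥ x < 0) :
    ∃ u : Fin d → ℝ, (∀ g ∈ A, 0 ≤ g ⬝ᵥ u) ∧ v ⬝ᵥ u < 0 ∧
      d ≤ Module.finrank ℝ (Submodule.span ℝ {g | g ∈ A ∧ g ⬝ᵥ u = 0}) + 1 := by
  set s : Fin d → ℝ := ∑ g ∈ A, g with hs
  have hsdot (u : Fin d → ℝ) : s ⬝ᵥ u = ∑ g ∈ A, g ⬝ᵥ u := sum_dotProduct ..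
  let Q : Set (Fin d → ℝ) := {u | (∀ g ∈ A, 0 ≤ g ⬝ᵥ u) ∧ s ⬝ᵥ u = 1}
  have hQ : IsCompact Q := by
    refine (isCompact_of_span_eq_top hA).of_isClosed_subset ?_ fun u hu g hg ↦ ⟨hu.1 g hg, ?_⟩
    · refine IsClosed.inter (?_ : IsClosed {u : Fin d → ℝ | ∀ g ∈ A, 0 ≤ g ⬝ᵥ u})
        (isClosed_eq (by fun_prop) continuous_const)
      simp only [Set.ofPred_forall]
      exact isClosed_biInter fun g _ ↦ isClosed_le continuous_const (by fun_prop)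
    · rw [← hu.2, hsdot]
      exact Finset.single_le_sum (f := fun g ↦ g ⬝ᵥ u) hu.1 hg
  have hpos : 0 < s ⬝ᵥ x := by
    rw [hsdot]
    refine (Finset.sum_nonneg hx).lt_of_ne' fun h0 ↦ hvx.ne ?_
    rw [Finset.sum_eq_zero_iff_of_nonneg hx] at h0
    rw [eq_zero_of_span_eq_top hA h0, dotProduct_zero]
  have hxQ : (s ⬝ᵥ x)⁻¹ • x ∈ Q := by
    refine ⟨fun g hg ↦ ?_, ?_⟩
    · rw [dotProduct_smul]
      exact mul_nonneg (inv_nonneg.2 hpos.le) (hx g hg)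
    · rw [dotProduct_smul, smul_eq_mul, inv_mul_cancel₀ hpos.ne']
  obtain ⟨u, hu, hvu⟩ := exists_extremePoint_dotProduct_le hQ v hxQ
  refine ⟨u, hu.1.1, hvu.trans_lt ?_, ?_⟩
  · rw [dotProduct_smul]
    exact mul_neg_of_pos_of_neg (inv_pos.2 hpos) hvx
  have htop : Submodule.span ℝ (insert s {g | g ∈ A ∧ g ⬝ᵥ u = 0}) = ⊤ := by
    by_contra hne
    obtain ⟨z, hz, hz0⟩ := exists_orthogonal_ne_zero hne
    have hsz := hz0 s (Set.mem_insert ..)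
    obtain ⟨ε, hε, h⟩ := exists_pos_forall_le_dotProduct_add_smul A 0 hu.1.1 (u := z)
      fun g hg h ↦ (hz0 g (Or.inr ⟨hg, h⟩)).ge
    obtain ⟨ε', hε', h'⟩ := exists_pos_forall_le_dotProduct_add_smul A 0 hu.1.1 (u := -z)
      fun g hg h ↦ by simp [hz0 g (Or.inr ⟨hg, h⟩)]
    exact hz (eq_zero_of_mem_extremePoints (ε := ε) (ε' := ε') hu hε hε'
      ⟨h, by simp [hsz, hu.1.2]⟩
      ⟨h', by simp [hsz, hu.1.2]⟩)
  have hrank := Submodule.finrank_add_le_finrank_add_finrank (Submodule.span ℝ {s})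
    (Submodule.span ℝ {g | g ∈ A ∧ g ⬝ᵥ u = 0})
  rw [← Submodule.span_insert, htop, finrank_top, Module.finrank_fin_fun] at hrank
  have h1 := finrank_span_le_card (R := ℝ) ({s} : Set (Fin d → ℝ))
  simp only [Set.toFinset_singleton, Finset.card_singleton] at h1
  omega

/-- From a vertex of a polytope there is an edge along which a linear functional that is not
minimal at the vertex decreases. -/
lemma exists_adjacent_extremePoint {d : ℕ} {V : Finset (Fin d → ℝ)} {D : Set (Fin d → ℝ)} {c : ℝ}
    (hD : D = {y | ∀ v ∈ V, c ≤ v ⬝ᵥ y}) (hDc : IsCompact D) {w y v : Fin d → ℝ}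
    (hw : w ∈ D.extremePoints ℝ) (hy : y ∈ D) (hvy : v ⬝ᵥ y < v ⬝ᵥ w) :
    ∃ w' ∈ D.extremePoints ℝ, v ⬝ᵥ w' < v ⬝ᵥ w ∧
      d ≤ Module.finrank ℝ
        (Submodule.span ℝ {g | (g ∈ V ∧ g ⬝ᵥ w = c) ∧ g ⬝ᵥ w' = c}) + 1 := by
  classical
  have hmem (x : Fin d → ℝ) : x ∈ D ↔ ∀ v ∈ V, c ≤ v ⬝ᵥ x := by rw [hD]; rfl
  set A := V.filter (fun g ↦ g ⬝ᵥ w = c) with hAdef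
  have hA : Submodule.span ℝ (A : Set (Fin d → ℝ)) = ⊤ := by
    rw [← span_active_eq_top hD hw]
    simp [hAdef]
  obtain ⟨u, huA, hvu, hrank⟩ := exists_extreme_ray hA (v := v) (x := y - w)
    (fun g hg ↦ by
      obtain ⟨hgV, hgw⟩ := Finset.mem_filter.1 hg
      rw [dotProduct_sub, hgw]
      linarith [(hmem y).1 hy g hgV])
    (by rw [dotProduct_sub]; linarith)
  obtain ⟨ε, hε, hεD⟩ := exists_pos_forall_le_dotProduct_add_smul V c ((hmem w).1 hw.1) (u := u)
    fun g hg h ↦ huA g (Finset.mem_filter.2 ⟨hg, h⟩)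
  set T : Set (Fin d → ℝ) := {g | g ∈ A ∧ g ⬝ᵥ u = 0} with hT
  have hsup : ∀ y ∈ D, ∀ g ∈ T, c ≤ g ⬝ᵥ y := fun y hy g hg ↦
    (hmem y).1 hy g (Finset.mem_filter.1 hg.1).1
  have hedge : w + ε • u ∈ {y ∈ D | ∀ g ∈ T, g ⬝ᵥ y = c} := by
    refine ⟨(hmem _).2 hεD, fun g hg ↦ ?_⟩
    rw [dotProduct_add, dotProduct_smul, hg.2, smul_zero, add_zero]
    exact (Finset.mem_filter.1 hg.1).2
  obtain ⟨w', hw', hvw'⟩ :=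
    exists_extremePoint_dotProduct_le (isCompact_dotProduct_eq hDc) v hedge
  refine ⟨w', (isExtreme_dotProduct_eq hsup).extremePoints_subset_extremePoints hw',
    hvw'.trans_lt ?_, hrank.trans ?_⟩
  · rw [dotProduct_add, dotProduct_smul, smul_eq_mul]
    linarith [mul_neg_of_pos_of_neg hε hvu]
  · gcongr
    exact Submodule.finrank_mono <| Submodule.span_mono fun g hg ↦
      ⟨Finset.mem_filter.1 hg.1, hw'.1.2 g hg⟩

/-- The linear span of a subset of a hyperplane avoiding the origin has one dimension more than
its affine span. -/
lemma finrank_span_eq_finrank_vectorSpan_add_one {d : ℕ} {F : Set (Fin d → ℝ)} {w : Fin d → ℝ}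
    {c : ℝ} (hc : c ≠ 0) (hF : ∀ x ∈ F, x ⬝ᵥ w = c) (hne : F.Nonempty) :
    Module.finrank ℝ (Submodule.span ℝ F) = Module.finrank ℝ (vectorSpan ℝ F) + 1 := by
  obtain ⟨p, hp⟩ := hne
  have hp0 : p ≠ 0 := by
    rintro rfl
    exact hc (by simpa using (hF 0 hp).symm)
  have hker : vectorSpan ℝ F ≤ LinearMap.ker (dotProductEquiv ℝ (Fin d) w) := by
    rw [vectorSpan_eq_span_vsub_set_right ℝ hp, Submodule.span_le]
    rintro _ ⟨x, hx, rfl⟩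
    simp [dotProduct_comm w, hF x hx, hF p hp]
  have hsup : Submodule.span ℝ F = vectorSpan ℝ F ⊔ Submodule.span ℝ {p} := by
    apply le_antisymm
    · rw [Submodule.span_le]
      intro x hx
      have := Submodule.add_mem_sup (vsub_mem_vectorSpan ℝ hx hp)
        (Submodule.mem_span_singleton_self (R := ℝ) p)
      simpa using this
    · refine sup_le ?_ (Submodule.span_mono (by simpa using hp))
      rw [vectorSpan_eq_span_vsub_set_right ℝ hp, Submodule.span_le]
      rintro _ ⟨x, hx, rfl⟩
      exact sub_mem (Submodule.subset_span hx) (Submodule.subset_span hp)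
  have hdisj : vectorSpan ℝ F ⊓ Submodule.span ℝ {p} = ⊥ := by
    rw [← disjoint_iff, Submodule.disjoint_span_singleton' hp0]
    intro h
    have := hker h
    rw [LinearMap.mem_ker, dotProductEquiv_apply_apply, dotProduct_comm, hF p hp] at this
    exact hc this
  have := Submodule.finrank_sup_add_finrank_inf_eq (vectorSpan ℝ F) (Submodule.span ℝ {p})
  rwa [← hsup, hdisj, finrank_bot, add_zero, finrank_span_singleton hp0] at this

lemma finrank_span_lt {d : ℕ} {S : Set (Fin d → ℝ)} {z : Fin d → ℝ} (hz : z ≠ 0)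
    (hS : ∀ g ∈ S, g ⬝ᵥ z = 0) : Module.finrank ℝ (Submodule.span ℝ S) < d := by
  have hlt : Submodule.span ℝ S ≠ ⊤ := fun h ↦ hz (eq_zero_of_span_eq_top h hS)
  simpa using Submodule.finrank_lt hlt

/-- The orthogonal complement of a subspace of codimension at most one is at most a line. -/
lemma exists_smul_eq_of_orthogonal {d : ℕ} {T : Set (Fin d → ℝ)} {a b : Fin d → ℝ} (ha : a ≠ 0)
    (haT : ∀ g ∈ T, g ⬝ᵥ a = 0) (hbT : ∀ g ∈ T, g ⬝ᵥ b = 0)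
    (hrank : d ≤ Module.finrank ℝ (Submodule.span ℝ T) + 1) : ∃ r : ℝ, r • a = b := by
  have haa : a ⬝ᵥ a ≠ 0 := by simpa using ha
  have hle : Submodule.span ℝ T ≤ LinearMap.ker (dotProductEquiv ℝ (Fin d) a) :=
    Submodule.span_le.2 fun g hg ↦ by simpa [dotProduct_comm a] using haT g hg
  have hlt : Submodule.span ℝ T < Submodule.span ℝ (insert a T) :=
    SetLike.lt_iff_le_and_exists.2 ⟨Submodule.span_mono (Set.subset_insert ..),
      a, Submodule.subset_span (Set.mem_insert ..), fun h ↦ haa (hle h)⟩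
  have htop : Submodule.span ℝ (insert a T) = ⊤ := by
    refine Submodule.eq_top_of_finrank_eq (le_antisymm (Submodule.finrank_le _) ?_)
    rw [Module.finrank_fin_fun]
    exact hrank.trans (Submodule.finrank_lt_finrank_of_lt hlt)
  refine ⟨a ⬝ᵥ b / a ⬝ᵥ a, (sub_eq_zero.1 (eq_zero_of_span_eq_top htop ?_)).symm⟩
  rintro g (rfl | hg)
  · rw [dotProduct_sub, dotProduct_smul, smul_eq_mul, div_mul_cancel₀ _ haa, sub_self]
  · rw [dotProduct_sub, dotProduct_smul, hbT g hg, haT g hg, smul_zero, sub_zero]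

/-- A line contains at most two extreme points of a given set. -/
lemma eq_of_extremePoints_of_finrank_span {d : ℕ} {D T : Set (Fin d → ℝ)}
    {w w₁ w₂ : Fin d → ℝ} {c : ℝ} (hw : w ∈ D.extremePoints ℝ) (hw₁ : w₁ ∈ D.extremePoints ℝ)
    (hw₂ : w₂ ∈ D.extremePoints ℝ) (h₁ : w₁ ≠ w) (h₂ : w₂ ≠ w)
    (hT : ∀ g ∈ T, g ⬝ᵥ w = c ∧ g ⬝ᵥ w₁ = c ∧ g ⬝ᵥ w₂ = c)
    (hrank : d ≤ Module.finrank ℝ (Submodule.span ℝ T) + 1) : w₁ = w₂ := by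
  obtain ⟨r, hr⟩ := exists_smul_eq_of_orthogonal (sub_ne_zero.2 h₁)
    (fun g hg ↦ by rw [dotProduct_sub, (hT g hg).1, (hT g hg).2.1, sub_self])
    (fun g hg ↦ by rw [dotProduct_sub, (hT g hg).1, (hT g hg).2.2, sub_self] :
      ∀ g ∈ T, g ⬝ᵥ (w₂ - w) = 0) hrank
  obtain rfl : w₂ = w + r • (w₁ - w) := by rw [hr]; abel
  have hr0 : r ≠ 0 := by
    rintro rfl
    simp at h₂
  by_contra hne
  have hr1 : r ≠ 1 := by
    rintro rfl
    simp at hne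
  rcases lt_or_gt_of_ne hr0 with hneg | hpos
  · have := hw.2 hw₁.1 hw₂.1 ⟨-r / (1 - r), 1 / (1 - r), div_pos (by linarith) (by linarith),
      div_pos (by linarith) (by linarith), by
        have : 1 - r ≠ 0 := by linarith
        field_simp; ring, by
        have : 1 - r ≠ 0 := by linarith
        ext i
        simp only [Pi.add_apply, Pi.smul_apply, Pi.sub_apply, smul_eq_mul]
        field_simp
        ring⟩
    exact h₁ this
  rcases lt_or_gt_of_ne hr1 with hlt | hgt
  · have := hw₂.2 hw.1 hw₁.1 ⟨1 - r, r, by linarith, by linarith, by ring, by module⟩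
    exact h₂ this.symm
  · have := hw₁.2 hw.1 hw₂.1 ⟨1 - 1 / r, 1 / r, by
        rw [sub_pos, div_lt_one hpos]; exact hgt, by positivity, by ring, by
        ext i
        simp only [Pi.add_apply, Pi.smul_apply, Pi.sub_apply, smul_eq_mul]
        field_simp
        ring⟩
    exact h₁ this.symm

lemma IsFace.eq_setOf {d : ℕ} {P F : Set (Fin d → ℝ)} (h : IsFace P F) :
    ∃ (g : Fin d → ℝ) (c : ℝ), (∀ x ∈ P, ∀ g' ∈ ({g} : Set (Fin d → ℝ)), c ≤ g' ⬝ᵥ x) ∧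
      F = {x ∈ P | ∀ g' ∈ ({g} : Set (Fin d → ℝ)), g' ⬝ᵥ x = c} := by
  obtain ⟨u, c, hle, rfl⟩ := h
  refine ⟨-u, -c, fun x hx g hg ↦ ?_, ?_⟩
  · rw [Set.mem_singleton_iff.1 hg, neg_dotProduct]
    exact neg_le_neg (hle x hx)
  · ext x
    simp only [Set.mem_ofPred_eq, Set.mem_singleton_iff, forall_eq, neg_dotProduct, neg_inj]
    rfl

lemma IsFace.isExtreme {d : ℕ} {P F : Set (Fin d → ℝ)} (h : IsFace P F) : IsExtreme ℝ P F := by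
  obtain ⟨g, c, hle, rfl⟩ := h.eq_setOf
  exact isExtreme_dotProduct_eq hle

lemma IsFace.isCompact {d : ℕ} {P F : Set (Fin d → ℝ)} (h : IsFace P F) (hP : IsCompact P) :
    IsCompact F := by
  obtain ⟨g, c, -, rfl⟩ := h.eq_setOf
  exact isCompact_dotProduct_eq hP

lemma IsFace.convex {d : ℕ} {P F : Set (Fin d → ℝ)} (h : IsFace P F) (hP : Convex ℝ P) :
    Convex ℝ F := by
  obtain ⟨g, c, -, rfl⟩ := h.eq_setOf
  exact convex_dotProduct_eq hP

/-- A face of a compact convex set is determined by its extreme points. -/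
lemma injOn_extremePoints_isFace {d : ℕ} {P : Set (Fin d → ℝ)} (hc : IsCompact P)
    (hconv : Convex ℝ P) :
    Set.InjOn (Set.extremePoints ℝ) {F : Set (Fin d → ℝ) | IsFace P F} := by
  intro F hF G hG h
  rw [← closure_convexHull_extremePoints (hF.isCompact hc) (hF.convex hconv), h,
    closure_convexHull_extremePoints (hG.isCompact hc) (hG.convex hconv)]

lemma finite_setOf_isFacetOfFacet {d : ℕ} {F : Set (Fin d → ℝ)} (hc : IsCompact F)
    (hconv : Convex ℝ F) (hfin : (F.extremePoints ℝ).Finite) :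
    {G : Set (Fin d → ℝ) | IsFacetOfFacet F G}.Finite :=
  Set.Finite.of_injOn (t := 𝒫 (F.extremePoints ℝ))
    (fun _ hG ↦ hG.1.isExtreme.extremePoints_subset_extremePoints)
    ((injOn_extremePoints_isFace hc hconv).mono fun _ hG ↦ hG.1) hfin.powerset

/-- A polytope `P` with vertex set `V` and its dual polytope `D`, such that the vertices of `P`
pair integrally with those of `D`. -/
structure IsReflexivePair {d : ℕ} (P D : Set (Fin d → ℝ)) (V : Finset (Fin d → ℝ)) : Prop where
  isCompact : IsCompact P
  convex : Convex ℝ P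
  extremePoints_eq : P.extremePoints ℝ = V
  zero_notMem : 0 ∉ V
  dual_eq : D = {y | ∀ v ∈ V, -1 ≤ v ⬝ᵥ y}
  neg_one_le : ∀ x ∈ P, ∀ y ∈ D, -1 ≤ x ⬝ᵥ y
  isCompact_dual : IsCompact D
  integral : ∀ v ∈ V, ∀ w ∈ D.extremePoints ℝ, ∃ k : ℤ, v ⬝ᵥ w = k

lemma IsReflexive.exists_isReflexivePair {d : ℕ} (hd : d ≠ 0) {P : Set (Fin d → ℝ)}
    (hP : IsReflexive P) : ∃ V, IsReflexivePair P (dualPolytope P) V := by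
  have : NeZero d := ⟨hd⟩
  obtain ⟨⟨S, hS, hPS⟩, h0, ⟨W, hW, hDW⟩⟩ := hP
  have hsub : P.extremePoints ℝ ⊆ S := hPS ▸ extremePoints_convexHull_subset
  have hfin := S.finite_toSet.subset hsub
  have hc : IsCompact P := hPS ▸ S.finite_toSet.isCompact_convexHull ℝ
  have hconv : Convex ℝ P := hPS ▸ convex_convexHull ℝ _
  refine ⟨hfin.toFinset, hc, hconv, by simp, fun h ↦ ?_, ?_, fun x hx y hy ↦ hy x hx,
    hDW ▸ W.finite_toSet.isCompact_convexHull ℝ, fun v hv w hw ↦ ?_⟩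
  · exact (disjoint_interior_extremePoints P).notMem_of_mem_left h0 (hfin.mem_toFinset.1 h)
  · ext y
    refine ⟨fun hy v hv ↦ hy v (hfin.mem_toFinset.1 hv).1, fun hy x hx ↦ ?_⟩
    have hhalf : closure (convexHull ℝ (P.extremePoints ℝ)) ⊆ {x | -1 ≤ x ⬝ᵥ y} := by
      refine closure_minimal (convexHull_min (fun v hv ↦ hy v (hfin.mem_toFinset.2 hv)) ?_)
        (isClosed_le continuous_const (by fun_prop))
      exact convex_halfSpace_ge ⟨fun a b ↦ add_dotProduct a b y, fun r a ↦ smul_dotProduct r a y⟩ _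
    rw [closure_convexHull_extremePoints hc hconv] at hhalf
    exact hhalf hx
  · have hwW : w ∈ W := by
      rw [hDW] at hw
      exact extremePoints_convexHull_subset hw
    choose a ha using hS v (hsub (hfin.mem_toFinset.1 hv))
    choose b hb using hW w hwW
    exact ⟨∑ i, a i * b i, by simp [dotProduct, ha, hb]⟩

namespace IsReflexivePair

variable {d : ℕ} {P D : Set (Fin d → ℝ)} {V : Finset (Fin d → ℝ)} {w : Fin d → ℝ}

/-- The face of `P` on which the pairing with `w` attains its minimal value `-1`. -/
def dualFace (P : Set (Fin d → ℝ)) (w : Fin d → ℝ) : Set (Fin d → ℝ) := {x ∈ P | x ⬝ᵥ w = -1}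

lemma isFace_inter_dualFace (h : ∀ x ∈ P, -1 ≤ x ⬝ᵥ w) (Q : Set (Fin d → ℝ)) (hQ : Q ⊆ P) :
    IsFace Q (Q ∩ dualFace P w) := by
  refine ⟨-w, 1, fun x hx ↦ ?_, ?_⟩
  · change -w ⬝ᵥ x ≤ 1
    rw [neg_dotProduct, dotProduct_comm]
    linarith [h x (hQ hx)]
  · ext x
    refine and_congr_right fun hx ↦ ?_
    change (x ∈ P ∧ x ⬝ᵥ w = -1) ↔ -w ⬝ᵥ x = 1
    rw [neg_dotProduct, dotProduct_comm w, neg_eq_iff_eq_neg]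
    exact and_iff_right (hQ hx)

lemma isFace_dualFace (h : IsReflexivePair P D V) (hw : w ∈ D) : IsFace P (dualFace P w) := by
  have := isFace_inter_dualFace (fun x hx ↦ h.neg_one_le x hx w hw) P subset_rfl
  rwa [Set.inter_eq_right.2 fun x hx ↦ hx.1] at this

lemma mem_iff (h : IsReflexivePair P D V) {v : Fin d → ℝ} : v ∈ V ↔ v ∈ P.extremePoints ℝ := by
  rw [h.extremePoints_eq, Finset.mem_coe]

lemma extremePoints_dualFace (h : IsReflexivePair P D V) (hw : w ∈ D) :
    (dualFace P w).extremePoints ℝ = V.filter (fun v ↦ v ⬝ᵥ w = -1) := by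
  rw [(h.isFace_dualFace hw).isExtreme.extremePoints_eq]
  ext v
  rw [Set.mem_inter_iff, Finset.mem_coe, Finset.mem_filter, h.mem_iff]
  exact ⟨fun hv ↦ ⟨hv.2, hv.1.2⟩, fun hv ↦ ⟨⟨hv.1.1, hv.2⟩, hv.1⟩⟩

lemma span_filter_eq_top (h : IsReflexivePair P D V) (hw : w ∈ D.extremePoints ℝ) :
    Submodule.span ℝ (V.filter (fun v ↦ v ⬝ᵥ w = -1) : Set (Fin d → ℝ)) = ⊤ := by
  rw [← span_active_eq_top h.dual_eq hw]
  simp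

lemma le_card_filter (h : IsReflexivePair P D V) (hw : w ∈ D.extremePoints ℝ) :
    d ≤ (V.filter (fun v ↦ v ⬝ᵥ w = -1)).card := by
  have := finrank_span_finset_le_card (R := ℝ) (V.filter (fun v ↦ v ⬝ᵥ w = -1))
  rwa [Set.finrank, h.span_filter_eq_top hw, finrank_top, Module.finrank_fin_fun] at this

lemma ne_zero (h : IsReflexivePair P D V) (hd : d ≠ 0) (hw : w ∈ D.extremePoints ℝ) :
    w ≠ 0 := by
  rintro rfl
  have := h.le_card_filter hw
  simp [eq_comm, hd] at this

lemma isFacet_dualFace (h : IsReflexivePair P D V) (hd : d ≠ 0) (hw : w ∈ D.extremePoints ℝ) :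
    IsFacet P (dualFace P w) := by
  have hsub : (V.filter (fun v ↦ v ⬝ᵥ w = -1) : Set (Fin d → ℝ)) ⊆ dualFace P w := by
    rw [← h.extremePoints_dualFace hw.1]
    exact extremePoints_subset
  have hne : (dualFace P w).Nonempty := by
    obtain ⟨v, hv⟩ := Finset.card_pos.1 ((Nat.pos_of_ne_zero hd).trans_le (h.le_card_filter hw))
    exact ⟨v, hsub hv⟩
  refine ⟨h.isFace_dualFace hw.1, hne, ?_⟩
  have hspan := finrank_span_eq_finrank_vectorSpan_add_one (by norm_num : (-1 : ℝ) ≠ 0)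
    (fun x hx ↦ hx.2) hne
  rw [top_le_iff.1 ((h.span_filter_eq_top hw).ge.trans (Submodule.span_mono hsub)), finrank_top,
    Module.finrank_fin_fun] at hspan
  omega

/-- A vertex of `P` on which a facet normal vanishes lies on a neighbouring facet. -/
lemma exists_adjacent (h : IsReflexivePair P D V) (hw : w ∈ D.extremePoints ℝ) {v : Fin d → ℝ}
    (hv : v ∈ V) (hvw : v ⬝ᵥ w = 0) : ∃ w' ∈ D.extremePoints ℝ, v ⬝ᵥ w' = -1 ∧
      d ≤ Module.finrank ℝ
        (Submodule.span ℝ {g | (g ∈ V ∧ g ⬝ᵥ w = -1) ∧ g ⬝ᵥ w' = -1}) + 1 := by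
  obtain ⟨ε, hε, hεD⟩ := exists_pos_forall_le_dotProduct_add_smul V (-1) (y := 0) (u := -v)
    (by simp) (by simp)
  have hv0 : v ≠ 0 := fun h0 ↦ h.zero_notMem (h0 ▸ hv)
  have hvv : 0 < v ⬝ᵥ v := lt_of_le_of_ne' (Finset.sum_nonneg fun i _ ↦ mul_self_nonneg (v i))
    (by simpa using hv0)
  obtain ⟨w', hw', hlt, hrank⟩ := exists_adjacent_extremePoint h.dual_eq h.isCompact_dual hw
    (y := 0 + ε • -v) (v := v) (by rw [h.dual_eq]; exact hεD) (by
      rw [hvw, zero_add, dotProduct_smul, dotProduct_neg, smul_eq_mul]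
      nlinarith)
  refine ⟨w', hw', ?_, hrank⟩
  have hge := h.neg_one_le v (h.mem_iff.1 hv).1 w' hw'.1
  obtain ⟨k, hk⟩ := h.integral v hv w' hw'
  rw [hvw, hk] at hlt
  rw [hk] at hge ⊢
  have h1 : k < 0 := by exact_mod_cast hlt
  have h2 : -1 ≤ k := by exact_mod_cast hge
  have : k = -1 := by omega
  simp [this]

lemma isFacetOfFacet (h : IsReflexivePair P D V) (hd : 2 ≤ d)
    {w' : Fin d → ℝ} (hw' : w' ∈ D.extremePoints ℝ) (hne : w' ≠ w)
    (hrank : d ≤ Module.finrank ℝ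
      (Submodule.span ℝ {g | (g ∈ V ∧ g ⬝ᵥ w = -1) ∧ g ⬝ᵥ w' = -1}) + 1) :
    IsFacetOfFacet (dualFace P w) (dualFace P w ∩ dualFace P w') := by
  have hsub : {g | (g ∈ V ∧ g ⬝ᵥ w = -1) ∧ g ⬝ᵥ w' = -1} ⊆ dualFace P w ∩ dualFace P w' :=
    fun g hg ↦ ⟨⟨(h.mem_iff.1 hg.1.1).1, hg.1.2⟩, (h.mem_iff.1 hg.1.1).1, hg.2⟩
  have hnonempty : (dualFace P w ∩ dualFace P w').Nonempty := by
    refine Set.Nonempty.mono hsub (Set.nonempty_iff_ne_empty.2 fun h0 ↦ ?_)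
    rw [h0, Submodule.span_empty, finrank_bot] at hrank
    omega
  refine ⟨isFace_inter_dualFace (fun x hx ↦ h.neg_one_le x hx w' hw'.1) _ fun x hx ↦ hx.1,
    hnonempty, ?_⟩
  have hspan := finrank_span_eq_finrank_vectorSpan_add_one (by norm_num : (-1 : ℝ) ≠ 0)
    (fun x hx ↦ hx.1.2) hnonempty
  have hlt := finrank_span_lt (S := dualFace P w ∩ dualFace P w') (sub_ne_zero.2 hne)
    fun g hg ↦ by rw [dotProduct_sub, hg.1.2, hg.2.2, sub_self]
  have hmono := Submodule.finrank_mono (Submodule.span_mono hsub (R := ℝ))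
  omega

lemma finite_setOf_isFacetOfFacet_dualFace (h : IsReflexivePair P D V) (hw : w ∈ D) :
    {G | IsFacetOfFacet (dualFace P w) G}.Finite :=
  finite_setOf_isFacetOfFacet ((h.isFace_dualFace hw).isCompact h.isCompact)
    ((h.isFace_dualFace hw).convex h.convex)
    (by rw [h.extremePoints_dualFace hw]; exact Finset.finite_toSet _)

/-- The number of vertices of `P` lying in the hyperplane parallel to a given facet through the
origin. -/
lemma card_filter_eq_zero_le (h : IsReflexivePair P D V) (hd : 2 ≤ d)
    (hw : w ∈ D.extremePoints ℝ) {α : ℕ}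
    (hα : ∀ w' ∈ D.extremePoints ℝ, (V.filter (fun v ↦ v ⬝ᵥ w' = -1)).card ≤ α) :
    (V.filter (fun v ↦ v ⬝ᵥ w = 0)).card ≤
      (α + 1 - d) * {G | IsFacetOfFacet (dualFace P w) G}.ncard := by
  classical
  choose! W hW hvW hrank using fun v (hv : v ∈ V.filter (fun v ↦ v ⬝ᵥ w = 0)) ↦
    h.exists_adjacent hw (Finset.mem_filter.1 hv).1 (Finset.mem_filter.1 hv).2
  have hne (v) (hv : v ∈ V.filter (fun v ↦ v ⬝ᵥ w = 0)) : W v ≠ w := fun h0 ↦ by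
    have h1 := hvW v hv
    rw [h0, (Finset.mem_filter.1 hv).2] at h1
    norm_num at h1
  have hfin := h.finite_setOf_isFacetOfFacet_dualFace hw.1
  rw [Set.ncard_eq_toFinset_card _ hfin]
  refine Finset.card_le_mul_card_image_of_maps_to (f := fun v ↦ dualFace P w ∩ dualFace P (W v))
    (fun v hv ↦ hfin.mem_toFinset.2
      (h.isFacetOfFacet hd (hW v hv) (hne v hv) (hrank v hv))) _ fun G _ ↦ ?_
  rcases Finset.eq_empty_or_nonempty
    {v ∈ V.filter (fun v ↦ v ⬝ᵥ w = 0) | dualFace P w ∩ dualFace P (W v) = G} with h0 | ⟨v₀, hv₀⟩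
  · rw [h0]
    exact Nat.zero_le _
  obtain ⟨hv₁, rfl⟩ := Finset.mem_filter.1 hv₀
  set T := (V.filter (fun v ↦ v ⬝ᵥ w = -1)).filter (fun v ↦ v ⬝ᵥ W v₀ = -1) with hT
  have hTrank : d ≤ Module.finrank ℝ (Submodule.span ℝ (T : Set (Fin d → ℝ))) + 1 := by
    have hcoe : (T : Set (Fin d → ℝ)) = {g | (g ∈ V ∧ g ⬝ᵥ w = -1) ∧ g ⬝ᵥ W v₀ = -1} := by
      simp only [hT, Finset.coe_filter, Finset.mem_filter]
    rw [hcoe]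
    exact hrank v₀ hv₁
  have hTcard : d ≤ T.card + 1 :=
    hTrank.trans (Nat.succ_le_succ (finrank_span_finset_le_card T))
  have hsub : {v ∈ V.filter (fun v ↦ v ⬝ᵥ w = 0) |
      dualFace P w ∩ dualFace P (W v) = dualFace P w ∩ dualFace P (W v₀)} ⊆
      V.filter (fun v ↦ v ⬝ᵥ W v₀ = -1) \ T := by
    intro v hv
    obtain ⟨hv, hG⟩ := Finset.mem_filter.1 hv
    have heq : W v = W v₀ := by
      refine eq_of_extremePoints_of_finrank_span (T := T) (c := -1) hw (hW v hv) (hW v₀ hv₁)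
        (hne v hv) (hne v₀ hv₁) (fun g hg ↦ ?_) hTrank
      simp only [hT, Finset.coe_filter, Finset.mem_filter, Set.mem_ofPred_eq] at hg
      have hgG : g ∈ dualFace P w ∩ dualFace P (W v₀) :=
        ⟨⟨(h.mem_iff.1 hg.1.1).1, hg.1.2⟩, (h.mem_iff.1 hg.1.1).1, hg.2⟩
      rw [← hG] at hgG
      exact ⟨hg.1.2, hgG.2.2, hg.2⟩
    have hvV := Finset.mem_filter.1 hv
    refine Finset.mem_sdiff.2 ⟨Finset.mem_filter.2 ⟨hvV.1, heq ▸ hvW v hv⟩, fun hvT ↦ ?_⟩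
    have := (Finset.mem_filter.1 (Finset.mem_filter.1 hvT).1).2
    rw [hvV.2] at this
    norm_num at this
  have hTsub : T ⊆ V.filter (fun v ↦ v ⬝ᵥ W v₀ = -1) :=
    Finset.filter_subset_filter _ (Finset.filter_subset _ _)
  have := Finset.card_le_card hsub
  rw [Finset.card_sdiff_of_subset hTsub] at this
  have := hα _ (hW v₀ hv₁)
  omega

lemma filter_eq_zero_eq_empty (h : IsReflexivePair P D V) (hd : d = 1)
    (hw : w ∈ D.extremePoints ℝ) : V.filter (fun v ↦ v ⬝ᵥ w = 0) = ∅ := by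
  refine Finset.filter_eq_empty_iff.2 fun v hv hvw ↦ ?_
  obtain ⟨r, hr⟩ := exists_smul_eq_of_orthogonal (T := ∅) (b := v) (h.ne_zero (by omega) hw)
    (by simp) (by simp) (by omega)
  rw [← hr, smul_dotProduct, smul_eq_mul, mul_eq_zero, dotProduct_self_eq_zero] at hvw
  refine h.zero_notMem ?_
  rcases hvw with rfl | h0
  · rwa [← hr, zero_smul] at hv
  · exact absurd h0 (h.ne_zero (by omega) hw)

/-- A facet with exactly `d` vertices has at most `d` facets. -/
lemma ncard_isFacetOfFacet_le (h : IsReflexivePair P D V) (hd : 2 ≤ d)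
    (hw : w ∈ D.extremePoints ℝ) (hcard : (V.filter (fun v ↦ v ⬝ᵥ w = -1)).card = d) :
    {G | IsFacetOfFacet (dualFace P w) G}.ncard ≤ d := by
  classical
  set A := V.filter (fun v ↦ v ⬝ᵥ w = -1) with hA
  have hF := h.isFacet_dualFace (by omega) hw
  have hFc := hF.1.isCompact h.isCompact
  have hFconv := hF.1.convex h.convex
  have hinj := injOn_extremePoints_isFace hFc hFconv
  have hchoose : ((A.powersetCard (d - 1)).image
      (fun s : Finset (Fin d → ℝ) ↦ (s : Set (Fin d → ℝ))) : Finset (Set (Fin d → ℝ))).card ≤ d := by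
    refine Finset.card_image_le.trans ?_
    rw [Finset.card_powersetCard, hcard, ← Nat.choose_symm (by omega),
      show d - (d - 1) = 1 by omega, Nat.choose_one_right]
  refine le_trans ?_ hchoose
  rw [← Set.ncard_coe_finset]
  refine Set.ncard_le_ncard_of_injOn (Set.extremePoints ℝ) (fun G hG ↦ ?_)
    (hinj.mono fun G hG ↦ hG.1) (Finset.finite_toSet _)
  have hext : G.extremePoints ℝ ⊆ A := by
    rw [hA, ← h.extremePoints_dualFace hw.1]
    exact hG.1.isExtreme.extremePoints_subset_extremePoints
  obtain ⟨s, hs⟩ := (A.finite_toSet.subset hext).exists_finset_coe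
  have hsA : s ⊆ A := by rwa [← hs, Finset.coe_subset] at hext
  rw [Finset.coe_image]
  refine ⟨s, Finset.mem_powersetCard.2 ⟨hsA, le_antisymm ?_ ?_⟩, hs⟩
  · have hle := Finset.card_le_card hsA
    by_contra! hlt
    have hsA' : s = A := Finset.eq_of_subset_of_card_le hsA (by omega)
    have hGF : G = dualFace P w := by
      rw [← closure_convexHull_extremePoints (hG.1.isCompact hFc) (hG.1.convex hFconv), ← hs,
        hsA', hA, ← h.extremePoints_dualFace hw.1, closure_convexHull_extremePoints hFc hFconv]
    have h1 := hG.2.2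
    rw [hGF, hF.2.2] at h1
    omega
  · have hspan := finrank_span_eq_finrank_vectorSpan_add_one (by norm_num : (-1 : ℝ) ≠ 0)
      (fun x hx ↦ (hG.1.isExtreme.subset hx).2) hG.2.1
    have hGs : G ⊆ Submodule.span ℝ (s : Set (Fin d → ℝ)) := by
      rw [← closure_convexHull_extremePoints (hG.1.isCompact hFc) (hG.1.convex hFconv), ← hs]
      exact closure_minimal (convexHull_min Submodule.subset_span (Submodule.convex _))
        (Submodule.closed_of_finiteDimensional _)
    have hle := (Submodule.finrank_mono (Submodule.span_le.2 hGs)).trans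
      (finrank_span_finset_le_card s)
    rw [hspan, hG.2.2] at hle
    omega

/-- Some facet normal has nonpositive sum over all vertices, so at most as many vertices lie beyond
the origin as on the facet itself. -/
lemma exists_card_le (h : IsReflexivePair P D V) : ∃ w ∈ D.extremePoints ℝ,
    V.card ≤ 2 * (V.filter (fun v ↦ v ⬝ᵥ w = -1)).card + (V.filter (fun v ↦ v ⬝ᵥ w = 0)).card := by
  obtain ⟨w, hw, hle⟩ := exists_extremePoint_dotProduct_le h.isCompact_dual (∑ v ∈ V, v) (x := 0)
    (by rw [h.dual_eq]; intro v _; simp)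
  refine ⟨w, hw, ?_⟩
  rw [dotProduct_zero, sum_dotProduct] at hle
  have key : ∀ v ∈ V, (1 : ℝ) ≤
      2 * (if v ⬝ᵥ w = -1 then 1 else 0) + (if v ⬝ᵥ w = 0 then 1 else 0) + v ⬝ᵥ w := by
    intro v hv
    obtain ⟨k, hk⟩ := h.integral v hv w hw
    have hge := h.neg_one_le v (h.mem_iff.1 hv).1 w hw.1
    rw [hk] at hge ⊢
    have hge' : -1 ≤ k := by exact_mod_cast hge
    rcases (by omega : k = -1 ∨ k = 0 ∨ 1 ≤ k) with rfl | rfl | hk1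
    · norm_num
    · norm_num
    · have : (1 : ℝ) ≤ k := by exact_mod_cast hk1
      rw [if_neg (by linarith), if_neg (by linarith)]
      linarith
  have hsum := Finset.sum_le_sum key
  rw [Finset.sum_add_distrib, Finset.sum_add_distrib, ← Finset.mul_sum, Finset.sum_boole,
    Finset.sum_boole, Finset.sum_const, nsmul_eq_mul, mul_one] at hsum
  have : (V.card : ℝ) ≤ 2 * ((V.filter (fun v ↦ v ⬝ᵥ w = -1)).card : ℝ) +
      ((V.filter (fun v ↦ v ⬝ᵥ w = 0)).card : ℝ) := by linarith
  exact_mod_cast this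

end IsReflexivePair

lemma le_vertex_bound {d a b n : ℝ} (hd : 0 ≤ d) (ha : 1 ≤ a) (hb : 0 ≤ b) (hn : n ≤ 2 * a + b) :
    n ≤ b + 2 + 2 * Real.sqrt ((a - 1) * (d + 1) * ((a - 1) + b)) := by
  have h : a - 1 ≤ Real.sqrt ((a - 1) * (d + 1) * ((a - 1) + b)) := by
    apply Real.le_sqrt_of_sq_le
    have h1 : 0 ≤ a - 1 := by linarith
    nlinarith [mul_nonneg h1 hb, mul_nonneg (mul_nonneg hd h1) hb, mul_nonneg hd (mul_nonneg h1 h1)]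
  linarith

/-- Debarre-type bound on the number of vertices of a reflexive polytope in
terms of the maximal number `α` of vertices of a facet and the maximal number `β` of facets
of a facet. -/
theorem vertex_bound_debarre {d α β : ℕ} (P : Set (Fin d → ℝ)) (hP : IsReflexive P)
    (hubα : ∀ F, IsFacet P F → (Set.extremePoints ℝ F).ncard ≤ α)
    (hmaxα : ∃ F, IsFacet P F ∧ (Set.extremePoints ℝ F).ncard = α)
    (hubβ : ∀ F, IsFacet P F → {G : Set (Fin d → ℝ) | IsFacetOfFacet F G}.ncard ≤ β)
    (hmaxβ : ∃ F, IsFacet P F ∧ {G : Set (Fin d → ℝ) | IsFacetOfFacet F G}.ncard = β) :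
    ((Set.extremePoints ℝ P).ncard : ℝ) ≤
      ((α : ℝ) - d + 1) * β + 2 +
        2 * Real.sqrt (((α : ℝ) - 1) * ((d : ℝ) + 1) *
          (((α : ℝ) - 1) + ((α : ℝ) - d + 1) * β)) ∧
    (IsSimplicial P →
      ((Set.extremePoints ℝ P).ncard : ℝ) ≤
        (d : ℝ) + 2 + 2 * Real.sqrt (((d : ℝ) ^ 2 - 1) * (2 * (d : ℝ) - 1))) := by
  rcases Nat.eq_zero_or_pos d with rfl | hd
  · have h1 : ((P.extremePoints ℝ).ncard : ℝ) ≤ 1 := by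
      exact_mod_cast Set.ncard_le_one_of_subsingleton _
    refine ⟨h1.trans ?_, fun _ ↦ h1.trans ?_⟩
    · have := Real.sqrt_nonneg (((α : ℝ) - 1) * (((0 : ℕ) : ℝ) + 1) *
        (((α : ℝ) - 1) + ((α : ℝ) - ((0 : ℕ) : ℝ) + 1) * β))
      have h2 : (0 : ℝ) ≤ ((α : ℝ) - ((0 : ℕ) : ℝ) + 1) * β := by
        rw [Nat.cast_zero, sub_zero]
        positivity
      linarith
    · have := Real.sqrt_nonneg ((((0 : ℕ) : ℝ) ^ 2 - 1) * (2 * ((0 : ℕ) : ℝ) - 1))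
      rw [Nat.cast_zero] at this ⊢
      linarith
  obtain ⟨V, h⟩ := hP.exists_isReflexivePair hd.ne'
  obtain ⟨w, hw, hcard⟩ := h.exists_card_le
  have hfacet (w' : Fin d → ℝ) (hw' : w' ∈ (dualPolytope P).extremePoints ℝ) :
      ((IsReflexivePair.dualFace P w').extremePoints ℝ).ncard =
        (V.filter (fun v ↦ v ⬝ᵥ w' = -1)).card := by
    rw [h.extremePoints_dualFace hw'.1, Set.ncard_coe_finset]
  have hα (w' : Fin d → ℝ) (hw' : w' ∈ (dualPolytope P).extremePoints ℝ) :
      (V.filter (fun v ↦ v ⬝ᵥ w' = -1)).card ≤ α :=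
    (hfacet w' hw').symm.trans_le (hubα _ (h.isFacet_dualFace hd.ne' hw'))
  have hdα : d ≤ α := (h.le_card_filter hw).trans (hα w hw)
  have hβ := hubβ _ (h.isFacet_dualFace hd.ne' hw)
  rw [h.extremePoints_eq, Set.ncard_coe_finset]
  have hd1 : (1 : ℝ) ≤ d := by exact_mod_cast hd
  have hdα' : (d : ℝ) ≤ α := by exact_mod_cast hdα
  refine ⟨le_vertex_bound (by linarith) (by linarith)
    (mul_nonneg (by linarith) (Nat.cast_nonneg β)) ?_, fun hsimp ↦ ?_⟩
  · have hzero : (V.filter (fun v ↦ v ⬝ᵥ w = 0)).card ≤ (α + 1 - d) * β := by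
      rcases (by omega : d = 1 ∨ 2 ≤ d) with h1 | h2
      · rw [h.filter_eq_zero_eq_empty h1 hw]
        exact Nat.zero_le _
      · exact (h.card_filter_eq_zero_le h2 hw hα).trans (Nat.mul_le_mul_left _ hβ)
    have hn : (V.card : ℝ) ≤ ((2 * α + (α + 1 - d) * β : ℕ) : ℝ) := by
      exact_mod_cast hcard.trans (by have := hα w hw; omega)
    rw [Nat.cast_add, Nat.cast_mul, Nat.cast_mul, Nat.cast_sub (by omega)] at hn
    push_cast at hn
    linarith
  · have hsd (w' : Fin d → ℝ) (hw' : w' ∈ (dualPolytope P).extremePoints ℝ) :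
        (V.filter (fun v ↦ v ⬝ᵥ w' = -1)).card = d :=
      (hfacet w' hw').symm.trans (hsimp _ (h.isFacet_dualFace hd.ne' hw'))
    have hzero : (V.filter (fun v ↦ v ⬝ᵥ w = 0)).card ≤ d := by
      rcases (by omega : d = 1 ∨ 2 ≤ d) with h1 | h2
      · rw [h.filter_eq_zero_eq_empty h1 hw]
        exact Nat.zero_le _
      · refine (h.card_filter_eq_zero_le h2 hw fun w' hw' ↦ (hsd w' hw').le).trans ?_
        rw [show d + 1 - d = 1 by omega, one_mul]
        exact h.ncard_isFacetOfFacet_le h2 hw (hsd w hw)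
    have hn : (V.card : ℝ) ≤ 2 * d + d := by
      exact_mod_cast hcard.trans (by rw [hsd w hw]; omega)
    refine (le_vertex_bound (d := d) (by linarith) hd1 (by linarith) hn).trans_eq ?_
    ring_nf

end
end

section
/- Let P ⊆ ℝ^d be a simplicial reflexive polytope and v a vertex of P. Then there are at most three vertices of P not contained in the star set st(v), and if there are exactly three such vertices then −v is a vertex of P. Moreover |V(P)| ≤ |∂P_v ∩ (ℤ^d/ℤv)| + 4, where P_v := π_v(P), and equality implies that −v is a vertex of P. -/
open scoped BigOperators

noncomputable section

/-- The combinatorial data of a simplicial reflexive polytope: its vertices, its facet functionals,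
and for each facet the coordinates with respect to the basis formed by the vertices of the facet. -/
structure FacetSystem (E : Type*) [AddCommGroup E] [Module ℝ E] where
  /-- the lattice -/
  lattice : AddSubgroup E
  /-- the vertices -/
  verts : Set E
  /-- the functionals `u` such that `u = 1` defines a facet -/
  normals : Set (Module.Dual ℝ E)
  /-- the vertices on the facet `u = 1` -/
  facet : Module.Dual ℝ E → Finset E
  /-- the coordinates with respect to the vertices of a facet -/
  coord : Module.Dual ℝ E → E → Module.Dual ℝ E
  /-- the dimension -/
  dim : ℕ
  mem_facet : ∀ {u}, u ∈ normals → ∀ {x}, x ∈ facet u ↔ x ∈ verts ∧ u x = 1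
  verts_subset : ∀ {x}, x ∈ verts → x ∈ lattice
  ne_zero : ∀ {x}, x ∈ verts → x ≠ 0
  integral : ∀ {u}, u ∈ normals → ∀ {x}, x ∈ lattice → ∃ n : ℤ, u x = n
  le_one : ∀ {u}, u ∈ normals → ∀ {x}, x ∈ verts → u x ≤ 1
  exists_eq_one : ∀ {x}, x ∈ lattice → x ≠ 0 → (∀ u ∈ normals, u x ≤ 1) → ∃ u ∈ normals, u x = 1
  card_facet : ∀ {u}, u ∈ normals → (facet u).card = dim
  sum_coord : ∀ {u}, u ∈ normals → ∀ x, ∑ e ∈ facet u, coord u e x • e = x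
  coord_self : ∀ {u}, u ∈ normals → ∀ {e}, e ∈ facet u → coord u e e = 1
  coord_of_ne : ∀ {u}, u ∈ normals → ∀ {e}, e ∈ facet u → ∀ {e'}, e' ∈ facet u → e ≠ e' →
    coord u e e' = 0
  exists_adjacent : ∀ {u}, u ∈ normals → ∀ {e}, e ∈ facet u → ∃ u' ∈ normals, ∃ t : ℝ, 0 < t ∧
    ∀ x, u' x = u x - t * coord u e x

namespace FacetSystem

variable {E : Type*} [AddCommGroup E] [Module ℝ E] (S : FacetSystem E)
  {u u' : Module.Dual ℝ E} {v w w₁ w₂ e x : E}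

lemma sum_coord_eq (hu : u ∈ S.normals) (x : E) : ∑ e ∈ S.facet u, S.coord u e x = u x := by
  conv_rhs => rw [← S.sum_coord hu x]
  rw [map_sum]
  refine Finset.sum_congr rfl fun e he => ?_
  rw [map_smul, ((S.mem_facet hu).1 he).2, smul_eq_mul, mul_one]

lemma eq_zero_of_coord_nonneg (hu : u ∈ S.normals) (hx : u x = 0)
    (h : ∀ e ∈ S.facet u, 0 ≤ S.coord u e x) : x = 0 := by
  have h0 := (Finset.sum_eq_zero_iff_of_nonneg h).1 ((S.sum_coord_eq hu x).trans hx)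
  rw [← S.sum_coord hu x]
  exact Finset.sum_eq_zero fun e he => by rw [h0 e he, zero_smul]

lemma coord_nonneg (hu : u ∈ S.normals) (hx : ∀ u ∈ S.normals, u x ≤ 1) (hux : u x = 1)
    (he : e ∈ S.facet u) : 0 ≤ S.coord u e x := by
  obtain ⟨u', hu', t, ht, h⟩ := S.exists_adjacent hu he
  have h1 := hx u' hu'
  rw [h, hux] at h1
  by_contra hc
  nlinarith [mul_pos ht (neg_pos.2 (not_le.1 hc))]

lemma le_zero_of_ne_one (hu : u ∈ S.normals) (hx : x ∈ S.lattice) (h1 : u x ≤ 1) (hne : u x ≠ 1) :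
    u x ≤ 0 := by
  obtain ⟨n, hn⟩ := S.integral hu hx
  rw [hn] at h1 hne ⊢
  have h2 : n ≤ 1 := by exact_mod_cast h1
  have h3 : n ≠ 1 := by exact_mod_cast hne
  exact_mod_cast (by omega : n ≤ 0)

lemma le_neg_one_of_ne_zero (hu : u ∈ S.normals) (hx : x ∈ S.lattice) (h1 : u x ≤ 0)
    (hne : u x ≠ 0) : u x ≤ -1 := by
  obtain ⟨n, hn⟩ := S.integral hu hx
  rw [hn] at h1 hne ⊢
  have h2 : n ≤ 0 := by exact_mod_cast h1
  have h3 : n ≠ 0 := by exact_mod_cast hne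
  exact_mod_cast (by omega : n ≤ -1)

lemma eq_one_of_coord_neg {t : ℝ} (hu' : u' ∈ S.normals) (hx : x ∈ S.lattice)
    (hx1 : u' x ≤ 1) (hux : u x = 0) (ht : 0 < t)
    (h : ∀ x, u' x = u x - t * S.coord u e x) (hc : S.coord u e x < 0) : u' x = 1 := by
  by_contra hne
  have := S.le_zero_of_ne_one hu' hx hx1 hne
  rw [h, hux] at this
  nlinarith [mul_pos ht (neg_pos.2 hc)]

/-- A point lies outside the star of `v` if no facet contains both. -/
def Apart (v w : E) : Prop := ∀ u ∈ S.normals, u v = 1 → u w ≠ 1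

variable {S}

lemma Apart.symm (h : S.Apart v w) : S.Apart w v := fun u hu hw hv => h u hu hv hw

lemma Apart.coord (h : S.Apart v w) (hv : v ∈ S.verts) (hw : w ∈ S.verts) (hu : u ∈ S.normals)
    (huv : u v = 1) (huw : u w = 0) :
    S.coord u v w < 0 ∧ ∀ e ∈ S.facet u, e ≠ v → 0 ≤ S.coord u e w := by
  have key : ∀ e ∈ S.facet u, e ≠ v → 0 ≤ S.coord u e w := by
    intro e he hev
    by_contra! hc
    obtain ⟨u', hu', t, ht, hadj⟩ := S.exists_adjacent hu he
    refine h u' hu' ?_ (S.eq_one_of_coord_neg hu' (S.verts_subset hw) (S.le_one hu' hw) huw ht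
      hadj hc)
    rw [hadj, huv, S.coord_of_ne hu he ((S.mem_facet hu).2 ⟨hv, huv⟩) hev]
    ring
  refine ⟨?_, key⟩
  by_contra! hc
  refine S.ne_zero hw (S.eq_zero_of_coord_nonneg hu huw fun e he => ?_)
  by_cases hev : e = v
  · rwa [hev]
  · exact key e he hev

/-- Two distinct vertices apart from `v` cannot both lie in the facet adjacent to `u` across `v`,
at height zero over `u`. -/
lemma Apart.eq_of_eq_zero (h₁ : S.Apart v w₁) (h₂ : S.Apart v w₂) (hv : v ∈ S.verts)
    (hw₁ : w₁ ∈ S.verts) (hw₂ : w₂ ∈ S.verts) (hu : u ∈ S.normals) (huv : u v = 1)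
    (hu' : u' ∈ S.normals) {t : ℝ} (ht : 0 < t) (hadj : ∀ x, u' x = u x - t * S.coord u v x)
    (hw₁u : u' w₁ = 1) (hw₂u : u w₂ = 0) : w₁ = w₂ := by
  classical
  by_contra hne
  have hw₂u' := S.eq_one_of_coord_neg hu' (S.verts_subset hw₂) (S.le_one hu' hw₂) hw₂u ht
    hadj (h₂.coord hv hw₂ hu huv hw₂u).1
  have hvf : v ∈ S.facet u := (S.mem_facet hu).2 ⟨hv, huv⟩
  have hsub : insert w₁ (insert w₂ ((S.facet u).erase v)) ⊆ S.facet u' := by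
    intro x hx
    simp only [Finset.mem_insert, Finset.mem_erase] at hx
    rw [S.mem_facet hu']
    rcases hx with rfl | rfl | ⟨hxv, hx⟩
    · exact ⟨hw₁, hw₁u⟩
    · exact ⟨hw₂, hw₂u'⟩
    · obtain ⟨hxV, hx1⟩ := (S.mem_facet hu).1 hx
      refine ⟨hxV, ?_⟩
      rw [hadj, hx1, S.coord_of_ne hu hvf hx hxv.symm]
      ring
  have hcard := Finset.card_le_card hsub
  have hn₁ : w₁ ∉ S.facet u := fun hm => h₁ u hu huv ((S.mem_facet hu).1 hm).2
  have hn₂ : w₂ ∉ S.facet u := fun hm => h₂ u hu huv ((S.mem_facet hu).1 hm).2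
  rw [Finset.card_insert_of_notMem (by simp [hne, hn₁]),
    Finset.card_insert_of_notMem (by simp [hn₂]), Finset.card_erase_of_mem hvf,
    S.card_facet hu, S.card_facet hu'] at hcard
  have := Finset.card_pos.2 ⟨v, hvf⟩
  rw [S.card_facet hu] at this
  omega

lemma Apart.not_both_zero (h₁ : S.Apart v w₁) (h₂ : S.Apart v w₂) (hv : v ∈ S.verts)
    (hw₁ : w₁ ∈ S.verts) (hw₂ : w₂ ∈ S.verts) (hne : w₁ ≠ w₂) (hu : u ∈ S.normals)
    (huv : u v = 1) (hw₁u : u w₁ = 0) : u w₂ ≠ 0 := by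
  intro hw₂u
  obtain ⟨u', hu', t, ht, hadj⟩ := S.exists_adjacent hu ((S.mem_facet hu).2 ⟨hv, huv⟩)
  exact hne (h₁.eq_of_eq_zero h₂ hv hw₁ hw₂ hu huv hu' ht hadj
    (S.eq_one_of_coord_neg hu' (S.verts_subset hw₁) (S.le_one hu' hw₁) hw₁u ht
    hadj (h₁.coord hv hw₁ hu huv hw₁u).1) hw₂u)

/-- If `u` contains `w₁` and vanishes at `v`, then the adjacent facet across `w₁` contains `v`,
and is strictly negative at any other vertex apart from `v`. -/
lemma Apart.adjacent_le_neg_one (h₁ : S.Apart v w₁) (h₂ : S.Apart v w₂) (hv : v ∈ S.verts)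
    (hw₁ : w₁ ∈ S.verts) (hw₂ : w₂ ∈ S.verts) (hne : w₁ ≠ w₂) (hu : u ∈ S.normals)
    (huv : u v = 0) (hw₁u : u w₁ = 1) (hu' : u' ∈ S.normals) {t : ℝ} (ht : 0 < t)
    (hadj : ∀ x, u' x = u x - t * S.coord u w₁ x) : u' v = 1 ∧ u' w₂ ≤ -1 := by
  have hc := (h₁.symm.coord hw₁ hv hu hw₁u huv).1
  have huv' : u' v = 1 := S.eq_one_of_coord_neg hu' (S.verts_subset hv) (S.le_one hu' hv) huv ht
    hadj hc
  refine ⟨huv', ?_⟩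
  refine S.le_neg_one_of_ne_zero hu' (S.verts_subset hw₂) (S.le_zero_of_ne_one hu'
    (S.verts_subset hw₂) (S.le_one hu' hw₂) (h₂ u' hu' huv')) fun h0 => ?_
  have hvf := (S.mem_facet hu').2 ⟨hv, huv'⟩
  have hw₁f := (S.mem_facet hu).2 ⟨hw₁, hw₁u⟩
  obtain ⟨u₂, hu₂, t₂, ht₂, hadj₂⟩ := S.exists_adjacent hu' hvf
  have hw₂u₂ := S.eq_one_of_coord_neg hu₂ (S.verts_subset hw₂) (S.le_one hu₂ hw₂) h0 ht₂
    hadj₂ (h₂.coord hv hw₂ hu' huv' h0).1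
  have hv₂ : u₂ v ≤ 0 := by
    refine S.le_zero_of_ne_one hu₂ (S.verts_subset hv) (S.le_one hu₂ hv) ?_
    rw [hadj₂, huv', S.coord_self hu' hvf]
    linarith
  have hrest : ∀ e ∈ S.facet u, e ≠ w₁ → u₂ e = 1 := by
    intro e he hew
    obtain ⟨heV, he1⟩ := (S.mem_facet hu).1 he
    have he' : u' e = 1 := by
      rw [hadj, he1, S.coord_of_ne hu hw₁f he hew.symm]
      ring
    have hev : v ≠ e := by
      rintro rfl
      linarith
    rw [hadj₂, he', S.coord_of_ne hu' hvf ((S.mem_facet hu').2 ⟨heV, he'⟩) hev]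
    ring
  classical
  have hform : ∀ x, u₂ x = u x + (u₂ w₁ - 1) * S.coord u w₁ x := by
    intro x
    conv_lhs => rw [← S.sum_coord hu x]
    rw [map_sum, ← S.sum_coord_eq hu x, ← Finset.add_sum_erase _ _ hw₁f,
      ← Finset.add_sum_erase _ (fun e => S.coord u e x) hw₁f,
      Finset.sum_congr rfl (g := fun e => S.coord u e x)]
    · simp only [map_smul, smul_eq_mul]
      ring
    · intro e he
      rw [map_smul, hrest e (Finset.mem_of_mem_erase he) (Finset.ne_of_mem_erase he),
        smul_eq_mul, mul_one]
  have hw₁le := S.le_one hu₂ hw₁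
  have hw₁1 : u₂ w₁ = 1 := by
    rw [hform v, huv] at hv₂
    nlinarith
  have hw₂u : u w₂ = 1 := by
    have := hform w₂
    rw [hw₂u₂, hw₁1] at this
    linarith
  have := (h₂.symm.coord hw₂ hv hu hw₂u huv).2 w₁ hw₁f hne
  linarith


lemma add_add_le_one (h₁ : S.Apart v w₁) (h₂ : S.Apart v w₂) (hv : v ∈ S.verts)
    (hw₁ : w₁ ∈ S.verts) (hw₂ : w₂ ∈ S.verts) (hne : w₁ ≠ w₂) (hu : u ∈ S.normals) :
    u (v + w₁ + w₂) ≤ 1 := by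
  have hle₁ := S.le_one hu hw₁
  have hle₂ := S.le_one hu hw₂
  simp only [map_add]
  by_cases huv : u v = 1
  · have := S.le_zero_of_ne_one hu (S.verts_subset hw₁) hle₁ (h₁ u hu huv)
    have := S.le_zero_of_ne_one hu (S.verts_subset hw₂) hle₂ (h₂ u hu huv)
    linarith
  · have hv0 := S.le_zero_of_ne_one hu (S.verts_subset hv) (S.le_one hu hv) huv
    by_cases e₁ : u w₁ = 1
    · by_cases e₂ : u w₂ = 1
      · by_cases hv00 : u v = 0
        · have a := (h₁.symm.coord hw₁ hv hu e₁ hv00).2 w₂ ((S.mem_facet hu).2 ⟨hw₂, e₂⟩) hne.symm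
          have b := (h₂.symm.coord hw₂ hv hu e₂ hv00).1
          linarith
        · have := S.le_neg_one_of_ne_zero hu (S.verts_subset hv) hv0 hv00
          linarith
      · have := S.le_zero_of_ne_one hu (S.verts_subset hw₂) hle₂ e₂
        linarith
    · have := S.le_zero_of_ne_one hu (S.verts_subset hw₁) hle₁ e₁
      linarith

lemma Apart.add_eq_zero_of_mem (h₁ : S.Apart v w₁) (h₂ : S.Apart v w₂) (hv : v ∈ S.verts)
    (hw₁ : w₁ ∈ S.verts) (hw₂ : w₂ ∈ S.verts) (hne : w₁ ≠ w₂) (hu : u ∈ S.normals)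
    (huv : u v = 0) (hw₁u : u w₁ = 1) (hw₂u : u w₂ = 0) : v + w₂ = 0 := by
  have hw₁f := (S.mem_facet hu).2 ⟨hw₁, hw₁u⟩
  obtain ⟨u', hu', t, ht, hadj⟩ := S.exists_adjacent hu hw₁f
  obtain ⟨ha, hb⟩ := h₁.adjacent_le_neg_one h₂ hv hw₁ hw₂ hne hu huv hw₁u hu' ht hadj
  refine S.eq_zero_of_coord_nonneg hu (by rw [map_add, huv, hw₂u, add_zero]) fun e he => ?_
  by_cases hew : e = w₁
  · rw [hadj, huv] at ha
    rw [hadj, hw₂u] at hb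
    rw [hew, map_add]
    by_contra! hc
    nlinarith [mul_pos ht (neg_pos.2 hc)]
  · have := S.coord_nonneg hu (x := v + w₁ + w₂)
      (fun u hu => add_add_le_one h₁ h₂ hv hw₁ hw₂ hne hu) (by
        rw [map_add, map_add, huv, hw₁u, hw₂u]; norm_num) he
    rw [map_add, map_add, S.coord_of_ne hu he hw₁f hew] at this
    rw [map_add]
    linarith

lemma coord_neg_of_mem (hv : v ∈ S.verts) (hw₁ : w₁ ∈ S.verts) (hw₂ : w₂ ∈ S.verts)
    (hne : w₁ ≠ w₂) (hv₁ : v + w₁ ≠ 0) (hle : ∀ u ∈ S.normals, u (v + w₁ + w₂) ≤ 1)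
    (hle₁ : ∀ u ∈ S.normals, u (v + w₁) ≤ 1)
    (hu : u ∈ S.normals) (huv : u v = -1) (hw₁u : u w₁ = 1) (hw₂u : u w₂ = 1) :
    ∃ k : ℤ, 0 < k ∧ k * S.coord u w₂ v = -1 := by
  have hw₁f := (S.mem_facet hu).2 ⟨hw₁, hw₁u⟩
  have hw₂f := (S.mem_facet hu).2 ⟨hw₂, hw₂u⟩
  have hx0 : u (v + w₁) = 0 := by rw [map_add, huv, hw₁u]; norm_num
  have hneg : S.coord u w₂ (v + w₁) < 0 := by
    by_contra! hc
    refine hv₁ (S.eq_zero_of_coord_nonneg hu hx0 fun e he => ?_)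
    by_cases hew : e = w₂
    · rwa [hew]
    · have := S.coord_nonneg hu hle (by rw [map_add, hx0, hw₂u]; norm_num) he
      rwa [map_add, S.coord_of_ne hu he hw₂f hew, add_zero] at this
  obtain ⟨u', hu', t, ht, hadj⟩ := S.exists_adjacent hu hw₂f
  have h1 := S.eq_one_of_coord_neg hu' (S.lattice.add_mem (S.verts_subset hv)
    (S.verts_subset hw₁)) (hle₁ u' hu') hx0 ht hadj hneg
  obtain ⟨n, hn⟩ := S.integral hu' (S.verts_subset hw₂)
  rw [hadj, hw₂u, S.coord_self hu hw₂f] at hn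
  have htn : t = ((1 - n : ℤ) : ℝ) := by push_cast; linarith
  refine ⟨1 - n, by exact_mod_cast htn ▸ ht, ?_⟩
  rw [← htn]
  rw [hadj, hx0, map_add, S.coord_of_ne hu hw₂f hw₁f hne.symm] at h1
  linarith

lemma Apart.coord_ne_neg_one (h₁ : S.Apart v w₁) (h₂ : S.Apart v w₂) (hv : v ∈ S.verts)
    (hw₁ : w₁ ∈ S.verts) (hw₂ : w₂ ∈ S.verts) (hne : w₁ ≠ w₂) (hu : u ∈ S.normals)
    (huv : u v = -1) (hw₁u : u w₁ = 1) (hw₂u : u w₂ = 1) (hneg : S.coord u w₂ v < 0) :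
    S.coord u w₁ v ≠ -1 := by
  classical
  intro hα
  have hw₁f := (S.mem_facet hu).2 ⟨hw₁, hw₁u⟩
  have hw₂f := (S.mem_facet hu).2 ⟨hw₂, hw₂u⟩
  obtain ⟨u', hu', t, ht, hadj⟩ := S.exists_adjacent hu hw₁f
  have hrest : ∀ e ∈ S.facet u, e ≠ w₁ → u' e = 1 := by
    intro e he hew
    rw [hadj, ((S.mem_facet hu).1 he).2, S.coord_of_ne hu hw₁f he hew.symm]
    ring
  have hw₁u' : u' w₁ ≤ 0 := by
    refine S.le_zero_of_ne_one hu' (S.verts_subset hw₁) (S.le_one hu' hw₁) ?_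
    rw [hadj, hw₁u, S.coord_self hu hw₁f]
    linarith
  have ht1 : t = 1 := by
    have h1 := S.le_zero_of_ne_one hu' (S.verts_subset hv) (S.le_one hu' hv)
      fun h => h₂ u' hu' h (hrest w₂ hw₂f hne.symm)
    rw [hadj, huv, hα] at h1
    rw [hadj, hw₁u, S.coord_self hu hw₁f] at hw₁u'
    linarith
  subst ht1
  have huv' : u' v = 0 := by rw [hadj, huv, hα]; norm_num
  have hw₂u' := hrest w₂ hw₂f hne.symm
  have hw₂f' := (S.mem_facet hu').2 ⟨hw₂, hw₂u'⟩
  obtain ⟨g, hg, s, hs, hadj'⟩ := S.exists_adjacent hu' hw₂f'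
  obtain ⟨hgv, hgw₁⟩ := h₂.adjacent_le_neg_one h₁ hv hw₂ hw₁ hne.symm hu' huv' hw₂u' hg hs hadj'
  have hgw₂ : g w₂ ≤ 0 := S.le_zero_of_ne_one hg (S.verts_subset hw₂) (S.le_one hg hw₂)
    (h₂ g hg hgv)
  have hgrest : ∀ e ∈ ((S.facet u).erase w₁).erase w₂, g e = 1 := by
    intro e he
    simp only [Finset.mem_erase] at he
    obtain ⟨he₂, he₁, he⟩ := he
    have he' := hrest e he he₁
    rw [hadj', he', S.coord_of_ne hu' hw₂f'
      ((S.mem_facet hu').2 ⟨((S.mem_facet hu).1 he).1, he'⟩) (Ne.symm he₂)]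
    ring
  have hw₂e : w₂ ∈ (S.facet u).erase w₁ := Finset.mem_erase.2 ⟨hne.symm, hw₂f⟩
  have hsum := S.sum_coord_eq hu v
  have hgsum : g v = ∑ e ∈ S.facet u, S.coord u e v * g e := by
    conv_lhs => rw [← S.sum_coord hu v]
    simp only [map_sum, map_smul, smul_eq_mul]
  rw [← Finset.add_sum_erase _ _ hw₁f, ← Finset.add_sum_erase _ _ hw₂e] at hsum hgsum
  rw [Finset.sum_congr rfl (g := fun e => S.coord u e v)
    (fun e he => by rw [hgrest e he, mul_one])] at hgsum
  rw [hα, huv] at hsum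
  rw [hα, hgv] at hgsum
  nlinarith [mul_nonneg (neg_nonneg.2 hneg.le) (neg_nonneg.2 hgw₂)]

lemma Apart.add_le_one (h : S.Apart v w) (hv : v ∈ S.verts) (hw : w ∈ S.verts)
    (hu : u ∈ S.normals) : u (v + w) ≤ 1 := by
  have hle := S.le_one hu hw
  rw [map_add]
  by_cases huv : u v = 1
  · have := S.le_zero_of_ne_one hu (S.verts_subset hw) hle (h u hu huv)
    linarith
  · have := S.le_zero_of_ne_one hu (S.verts_subset hv) (S.le_one hu hv) huv
    linarith

theorem Apart.add_add_eq_zero_or (h₁ : S.Apart v w₁) (h₂ : S.Apart v w₂) (hv : v ∈ S.verts)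
    (hw₁ : w₁ ∈ S.verts) (hw₂ : w₂ ∈ S.verts) (hne : w₁ ≠ w₂) (hv₁ : v + w₁ ≠ 0)
    (hv₂ : v + w₂ ≠ 0) : v + w₁ + w₂ = 0 ∨ (2 : ℝ) • v + w₁ + w₂ = 0 := by
  classical
  by_cases hy : v + w₁ + w₂ = 0
  · exact Or.inl hy
  right
  have hle : ∀ u ∈ S.normals, u (v + w₁ + w₂) ≤ 1 :=
    fun u hu => add_add_le_one h₁ h₂ hv hw₁ hw₂ hne hu
  have hle' : ∀ u ∈ S.normals, u (v + w₂ + w₁) ≤ 1 :=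
    fun u hu => add_add_le_one h₂ h₁ hv hw₂ hw₁ hne.symm hu
  have hlat := S.lattice.add_mem (S.lattice.add_mem (S.verts_subset hv) (S.verts_subset hw₁))
    (S.verts_subset hw₂)
  obtain ⟨u, hu, hu1⟩ := S.exists_eq_one hlat hy hle
  have hle₁ := S.le_one hu hw₁
  have hle₂ := S.le_one hu hw₂
  have hu1' := hu1
  rw [map_add, map_add] at hu1'
  by_cases huv : u v = 1
  · have a₁ := S.le_zero_of_ne_one hu (S.verts_subset hw₁) hle₁ (h₁ u hu huv)
    have a₂ := S.le_zero_of_ne_one hu (S.verts_subset hw₂) hle₂ (h₂ u hu huv)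
    exact absurd (by linarith) (h₁.not_both_zero h₂ hv hw₁ hw₂ hne hu huv (by linarith))
  have hv0 := S.le_zero_of_ne_one hu (S.verts_subset hv) (S.le_one hu hv) huv
  by_cases e₁ : u w₁ = 1
  swap
  · have a₁ := S.le_zero_of_ne_one hu (S.verts_subset hw₁) hle₁ e₁
    exact absurd (h₂.add_eq_zero_of_mem h₁ hv hw₂ hw₁ hne.symm hu (by linarith) (by linarith)
      (by linarith)) hv₁
  by_cases e₂ : u w₂ = 1
  swap
  · have a₂ := S.le_zero_of_ne_one hu (S.verts_subset hw₂) hle₂ e₂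
    exact absurd (h₁.add_eq_zero_of_mem h₂ hv hw₁ hw₂ hne hu (by linarith) (by linarith)
      (by linarith)) hv₂
  have huv1 : u v = -1 := by linarith
  obtain ⟨k, hk, hkβ⟩ := coord_neg_of_mem hv hw₁ hw₂ hne hv₁ hle
    (fun u hu => h₁.add_le_one hv hw₁ hu) hu huv1 e₁ e₂
  obtain ⟨l, hl, hlα⟩ := coord_neg_of_mem hv hw₂ hw₁ hne.symm hv₂ hle'
    (fun u hu => h₂.add_le_one hv hw₂ hu) hu huv1 e₂ e₁
  have hkR : (0 : ℝ) < k := by exact_mod_cast hk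
  have hlR : (0 : ℝ) < l := by exact_mod_cast hl
  have hβneg : S.coord u w₂ v < 0 := by
    by_contra! hc
    nlinarith [mul_nonneg hkR.le hc]
  have hαneg : S.coord u w₁ v < 0 := by
    by_contra! hc
    nlinarith [mul_nonneg hlR.le hc]
  have hl2 : 2 ≤ l := by
    by_contra! hc
    obtain rfl : l = 1 := by omega
    exact h₁.coord_ne_neg_one h₂ hv hw₁ hw₂ hne hu huv1 e₁ e₂ hβneg (by simpa using hlα)
  have hk2 : 2 ≤ k := by
    by_contra! hc
    obtain rfl : k = 1 := by omega
    exact h₂.coord_ne_neg_one h₁ hv hw₂ hw₁ hne.symm hu huv1 e₂ e₁ hαneg (by simpa using hkβ)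
  have hkR2 : (2 : ℝ) ≤ k := by exact_mod_cast hk2
  have hlR2 : (2 : ℝ) ≤ l := by exact_mod_cast hl2
  have hα : -S.coord u w₁ v ≤ 1 / 2 := by nlinarith
  have hβ : -S.coord u w₂ v ≤ 1 / 2 := by nlinarith
  have hw₁f := (S.mem_facet hu).2 ⟨hw₁, e₁⟩
  have hw₂f := (S.mem_facet hu).2 ⟨hw₂, e₂⟩
  refine S.eq_zero_of_coord_nonneg hu ?_ fun e he => ?_
  · rw [map_add, map_add, map_smul, huv1, e₁, e₂]
    norm_num
  rw [map_add, map_add, map_smul, smul_eq_mul]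
  by_cases he₁ : e = w₁
  · subst he₁
    rw [S.coord_self hu he, S.coord_of_ne hu he hw₂f hne]
    linarith
  by_cases he₂ : e = w₂
  · subst he₂
    rw [S.coord_self hu he, S.coord_of_ne hu he hw₁f hne.symm]
    linarith
  have := S.coord_nonneg hu hle hu1 he
  rw [map_add, map_add] at this
  rw [S.coord_of_ne hu he hw₁f he₁, S.coord_of_ne hu he hw₂f he₂] at this ⊢
  linarith

variable (S) in
/-- At most two vertices other than `-v` are apart from `v`. -/
theorem ncard_apart_le_two (hv : v ∈ S.verts) :
    {w ∈ S.verts | S.Apart v w ∧ w ≠ -v}.ncard ≤ 2 := by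
  by_contra! h
  obtain ⟨a, b, c, ⟨ha, haa, hav⟩, ⟨hb, hba, hbv⟩, ⟨hc, hca, hcv⟩, hab, hac, hbc⟩ :=
    Set.two_lt_ncard_iff (Set.finite_of_ncard_pos (by omega)) |>.1 h
  have hav' : v + a ≠ 0 := fun h => hav (neg_eq_of_add_eq_zero_right h).symm
  have hbv' : v + b ≠ 0 := fun h => hbv (neg_eq_of_add_eq_zero_right h).symm
  have hcv' : v + c ≠ 0 := fun h => hcv (neg_eq_of_add_eq_zero_right h).symm
  have cancel : ∀ {z p q r : E}, z + p + q = 0 → z + p + r = 0 → q = r :=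
    fun h h' => add_left_cancel (h.trans h'.symm)
  have swap : ∀ {z p q : E}, z + p + q = 0 → z + q + p = 0 := fun h => by
    rwa [add_right_comm]
  rcases haa.add_add_eq_zero_or hba hv ha hb hab hav' hbv' with h1 | h1 <;>
  rcases haa.add_add_eq_zero_or hca hv ha hc hac hav' hcv' with h2 | h2 <;>
  rcases hba.add_add_eq_zero_or hca hv hb hc hbc hbv' hcv' with h3 | h3
  · exact hbc (cancel h1 h2)
  · exact hbc (cancel h1 h2)
  · exact hac (cancel (swap h1) h3)
  · exact hab (cancel (swap h2) (swap h3))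
  · exact hab (cancel (swap h2) (swap h3))
  · exact hac (cancel (swap h1) h3)
  · exact hbc (cancel h1 h2)
  · exact hbc (cancel h1 h2)

variable (S) in
/-- The vertices of a facet through `v` other than `v` lie on a common supporting hyperplane
parallel to `v`. -/
lemma exists_supporting_functional (hu : u ∈ S.normals) (hv : v ∈ S.facet u)
    (he : e ∈ S.facet u) (hev : e ≠ v) :
    ∃ f : Module.Dual ℝ E, f v = 0 ∧ f e = 1 ∧ ∀ x, (∀ u ∈ S.normals, u x ≤ 1) → f x ≤ 1 := by
  obtain ⟨u', hu', t, ht, hadj⟩ := S.exists_adjacent hu hv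
  obtain ⟨hvV, huv⟩ := (S.mem_facet hu).1 hv
  refine ⟨u - S.coord u v, ?_, ?_, fun x hx => ?_⟩
  · rw [LinearMap.sub_apply, huv, S.coord_self hu hv, sub_self]
  · rw [LinearMap.sub_apply, ((S.mem_facet hu).1 he).2, S.coord_of_ne hu hv he hev.symm, sub_zero]
  · have ht1 : 1 ≤ t := by
      have := S.le_zero_of_ne_one hu' (S.verts_subset hvV) (S.le_one hu' hvV) (by
        rw [hadj, huv, S.coord_self hu hv]; linarith)
      rw [hadj, huv, S.coord_self hu hv] at this
      linarith
    have a := hx u hu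
    have b := hx u' hu'
    rw [hadj] at b
    rw [LinearMap.sub_apply]
    nlinarith

end FacetSystem

section Polytope

open Set Filter Topology

variable {d : ℕ} {P : Set (Fin d → ℝ)}

/-- The functional `x ↦ -⟨x, y⟩`, so that `y ∈ P*` if and only if `outerNormal y ≤ 1` on `P`. -/
def outerNormal (d : ℕ) : (Fin d → ℝ) ≃ₗ[ℝ] Module.Dual ℝ (Fin d → ℝ) :=
  (LinearEquiv.neg ℝ).trans (dotProductEquiv ℝ (Fin d))

lemma outerNormal_apply (x y : Fin d → ℝ) : outerNormal d y x = -dotProd x y := by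
  simp [outerNormal, dotProd, dotProduct, mul_comm]

lemma mem_dualPolytope {y : Fin d → ℝ} :
    y ∈ dualPolytope P ↔ ∀ x ∈ P, outerNormal d y x ≤ 1 := by
  simp only [dualPolytope, mem_ofPred_eq, outerNormal_apply, neg_le]

lemma IsLatticePoint.add {x y : Fin d → ℝ} (hx : IsLatticePoint x) (hy : IsLatticePoint y) :
    IsLatticePoint (x + y) := fun i => by
  obtain ⟨a, ha⟩ := hx i
  obtain ⟨b, hb⟩ := hy i
  exact ⟨a + b, by simp [ha, hb]⟩

lemma IsLatticePoint.neg {x : Fin d → ℝ} (hx : IsLatticePoint x) : IsLatticePoint (-x) :=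
  fun i => by
    obtain ⟨a, ha⟩ := hx i
    exact ⟨-a, by simp [ha]⟩

lemma IsLatticePoint.zsmul {x : Fin d → ℝ} (hx : IsLatticePoint x) (n : ℤ) :
    IsLatticePoint ((n : ℝ) • x) := fun i => by
  obtain ⟨a, ha⟩ := hx i
  exact ⟨n * a, by simp [ha]⟩

lemma IsLatticePoint.exists_dotProd_eq {x y : Fin d → ℝ} (hx : IsLatticePoint x)
    (hy : IsLatticePoint y) : ∃ n : ℤ, dotProd x y = n := by
  choose a ha using hx
  choose b hb using hy
  exact ⟨∑ i, a i * b i, by simp [dotProd, ha, hb]⟩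

lemma Bornology.IsBounded.finite_isLatticePoint {A : Set (Fin d → ℝ)}
    (hA : Bornology.IsBounded A) : {x ∈ A | IsLatticePoint x}.Finite := by
  obtain ⟨R, hR⟩ := hA.exists_norm_le
  refine ((Set.Finite.pi' fun _ : Fin d => Set.finite_Icc (-⌈R⌉) ⌈R⌉).image
    fun (a : Fin d → ℤ) i => (a i : ℝ)).subset ?_
  rintro x ⟨hxA, hx⟩
  choose a ha using hx
  refine ⟨a, fun i => ?_, funext fun i => (ha i).symm⟩
  have h1 := (norm_le_pi_norm x i).trans (hR x hxA)
  rw [ha i, Real.norm_eq_abs, abs_le] at h1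
  have h2 := Int.le_ceil R
  constructor
  · exact_mod_cast (by push_cast; linarith : ((-⌈R⌉ : ℤ) : ℝ) ≤ a i)
  · exact_mod_cast h1.2.trans h2

/-- The lattice `ℤ^d` as an additive subgroup of `ℝ^d`. -/
def integerLattice (d : ℕ) : AddSubgroup (Fin d → ℝ) where
  carrier := {x | IsLatticePoint x}
  zero_mem' := fun _ => ⟨0, by simp⟩
  add_mem' := IsLatticePoint.add
  neg_mem' := IsLatticePoint.neg

namespace IsLatticePolytope

lemma isCompact (hP : IsLatticePolytope P) : IsCompact P := by
  obtain ⟨V, -, rfl⟩ := hP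
  exact V.finite_toSet.isCompact_convexHull ℝ

lemma convex (hP : IsLatticePolytope P) : Convex ℝ P := by
  obtain ⟨V, -, rfl⟩ := hP
  exact convex_convexHull ℝ _

lemma finite_extremePoints (hP : IsLatticePolytope P) : (extremePoints ℝ P).Finite := by
  obtain ⟨V, -, rfl⟩ := hP
  exact V.finite_toSet.subset extremePoints_convexHull_subset

lemma isLatticePoint (hP : IsLatticePolytope P) {x : Fin d → ℝ} (hx : x ∈ extremePoints ℝ P) :
    IsLatticePoint x := by
  obtain ⟨V, hV, rfl⟩ := hP
  exact hV x (extremePoints_convexHull_subset hx)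

lemma convexHull_extremePoints (hP : IsLatticePolytope P) :
    convexHull ℝ (extremePoints ℝ P) = P := by
  rw [← (hP.finite_extremePoints.isClosed_convexHull ℝ).closure_eq]
  exact closure_convexHull_extremePoints hP.isCompact hP.convex

lemma le_one_of_extremePoints (hP : IsLatticePolytope P) {f : Module.Dual ℝ (Fin d → ℝ)}
    (hf : ∀ x ∈ extremePoints ℝ P, f x ≤ 1) : ∀ x ∈ P, f x ≤ 1 := by
  intro x hx
  rw [← hP.convexHull_extremePoints] at hx
  exact convexHull_min (t := {x | f x ≤ 1}) hf (convex_halfSpace_le f.isLinear 1) hx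

lemma mem_dualPolytope_iff (hP : IsLatticePolytope P) {y : Fin d → ℝ} :
    y ∈ dualPolytope P ↔ ∀ x ∈ extremePoints ℝ P, outerNormal d y x ≤ 1 :=
  mem_dualPolytope.trans ⟨fun h x hx => h x hx.1, hP.le_one_of_extremePoints⟩

end IsLatticePolytope

lemma exists_smul_mem_of_zero_mem_interior (h0 : (0 : Fin d → ℝ) ∈ interior P)
    (z : Fin d → ℝ) : ∃ ε : ℝ, 0 < ε ∧ ε • z ∈ P ∧ -(ε • z) ∈ P := by
  have h : P ∈ 𝓝 (0 : Fin d → ℝ) := mem_interior_iff_mem_nhds.1 h0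
  have h1 : Tendsto (fun δ : ℝ => δ • z) (𝓝[>] 0) (𝓝 0) := by
    have : Tendsto (fun δ : ℝ => δ • z) (𝓝 0) (𝓝 ((0 : ℝ) • z)) :=
      (continuous_id.smul continuous_const).tendsto 0
    rw [zero_smul] at this
    exact this.mono_left nhdsWithin_le_nhds
  have h2 : Tendsto (fun δ : ℝ => -(δ • z)) (𝓝[>] 0) (𝓝 0) := by simpa using h1.neg
  obtain ⟨ε, ⟨a, b⟩, c⟩ := ((h1.eventually_mem h).and (h2.eventually_mem h)).and
    (self_mem_nhdsWithin) |>.exists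
  exact ⟨ε, c, a, b⟩

lemma linearMap_eq_zero_of_nonpos (h0 : (0 : Fin d → ℝ) ∈ interior P)
    {f : Module.Dual ℝ (Fin d → ℝ)} (hf : ∀ x ∈ P, f x ≤ 0) : f = 0 := by
  ext1 i
  ext
  obtain ⟨ε, hε, h1, h2⟩ := exists_smul_mem_of_zero_mem_interior h0
    (LinearMap.single ℝ (fun _ => ℝ) i 1)
  have a := hf _ h1
  have b := hf _ h2
  rw [map_neg, map_smul, smul_eq_mul] at b
  rw [map_smul, smul_eq_mul] at a
  have : ε * f (LinearMap.single ℝ (fun _ => ℝ) i 1) = 0 := by linarith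
  simpa using (mul_eq_zero.1 this).resolve_left hε.ne'

lemma ne_zero_of_mem_extremePoints (hd : d ≠ 0) (h0 : (0 : Fin d → ℝ) ∈ interior P)
    {x : Fin d → ℝ} (hx : x ∈ extremePoints ℝ P) : x ≠ 0 := by
  rintro rfl
  have : NeZero d := ⟨hd⟩
  obtain ⟨z, hz⟩ := exists_ne (0 : Fin d → ℝ)
  obtain ⟨ε, hε, h1, h2⟩ := exists_smul_mem_of_zero_mem_interior h0 z
  have := hx.2 h1 h2 ⟨1 / 2, 1 / 2, by norm_num, by norm_num, by norm_num, by simp⟩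
  exact hz ((smul_eq_zero.1 this).resolve_left hε.ne')

namespace IsReflexive

lemma mem_of_le_one (hP : IsReflexive P) {x : Fin d → ℝ}
    (h : ∀ y ∈ extremePoints ℝ (dualPolytope P), outerNormal d y x ≤ 1) : x ∈ P := by
  by_contra hx
  obtain ⟨f, s, hfs, hsx⟩ := geometric_hahn_banach_closed_point hP.1.convex
    hP.1.isCompact.isClosed hx
  have hs : 0 < s := by simpa using hfs 0 (interior_subset hP.2.1)
  obtain ⟨y, hy⟩ := (outerNormal d).surjective (s⁻¹ • f.toLinearMap)
  have hyD : y ∈ dualPolytope P := mem_dualPolytope.2 fun p hp => by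
    rw [hy]
    change s⁻¹ * f p ≤ 1
    rw [inv_mul_le_iff₀ hs, mul_one]
    exact (hfs p hp).le
  rw [← hP.2.2.convexHull_extremePoints] at hyD
  have hconv : Convex ℝ {y | outerNormal d y x ≤ 1} :=
    convex_halfSpace_le ((LinearMap.applyₗ x).comp (outerNormal d).toLinearMap).isLinear 1
  have h1 : outerNormal d y x ≤ 1 := convexHull_min h hconv hyD
  rw [hy] at h1
  change s⁻¹ * f x ≤ 1 at h1
  rw [inv_mul_le_iff₀ hs, mul_one] at h1
  linarith

lemma mem_iff_le_one (hP : IsReflexive P) {x : Fin d → ℝ} :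
    x ∈ P ↔ ∀ y ∈ extremePoints ℝ (dualPolytope P), outerNormal d y x ≤ 1 :=
  ⟨fun hx _ hy => mem_dualPolytope.1 hy.1 x hx, hP.mem_of_le_one⟩

lemma exists_outerNormal_eq_int (hP : IsReflexive P) {x y : Fin d → ℝ} (hx : IsLatticePoint x)
    (hy : y ∈ extremePoints ℝ (dualPolytope P)) : ∃ n : ℤ, outerNormal d y x = n := by
  obtain ⟨n, hn⟩ := hx.exists_dotProd_eq (hP.2.2.isLatticePoint hy)
  exact ⟨-n, by rw [outerNormal_apply, hn]; simp⟩

lemma exists_outerNormal_eq_one (hP : IsReflexive P) {x : Fin d → ℝ} (hx : IsLatticePoint x)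
    (hx0 : x ≠ 0) (hxP : x ∈ P) :
    ∃ y ∈ extremePoints ℝ (dualPolytope P), outerNormal d y x = 1 := by
  by_contra! hne
  have hle : ∀ y ∈ extremePoints ℝ (dualPolytope P), outerNormal d y x ≤ 0 := by
    intro y hy
    obtain ⟨n, hn⟩ := hP.exists_outerNormal_eq_int hx hy
    have h1 := hP.mem_iff_le_one.1 hxP y hy
    have h2 := hne y hy
    rw [hn] at h1 h2 ⊢
    have h3 : n ≤ 1 := by exact_mod_cast h1
    have h4 : n ≠ 1 := by exact_mod_cast h2
    exact_mod_cast (by omega : n ≤ 0)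
  obtain ⟨R, hR⟩ := hP.1.isCompact.isBounded.exists_norm_le
  obtain ⟨n, hn⟩ := exists_nat_gt (R / ‖x‖)
  have hmem : (n : ℝ) • x ∈ P := hP.mem_of_le_one fun y hy => by
    rw [map_smul, smul_eq_mul]
    nlinarith [hle y hy, n.cast_nonneg (α := ℝ)]
  have h1 := hR _ hmem
  rw [norm_smul, Real.norm_natCast] at h1
  rw [div_lt_iff₀ (norm_pos_iff.2 hx0)] at hn
  linarith

lemma span_active_eq_top (hP : IsReflexive P) {y : Fin d → ℝ}
    (hy : y ∈ extremePoints ℝ (dualPolytope P)) :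
    Submodule.span ℝ {x ∈ extremePoints ℝ P | outerNormal d y x = 1} = ⊤ := by
  by_contra hne
  obtain ⟨f, hf0, hf⟩ := Submodule.exists_le_ker_of_lt_top _ (lt_top_iff_ne_top.2 hne)
  obtain ⟨m, rfl⟩ := (outerNormal d).surjective f
  have hm0 : m ≠ 0 := by
    rintro rfl
    simp at hf0
  have hev : ∀ᶠ δ : ℝ in 𝓝 0, ∀ x ∈ extremePoints ℝ P,
      outerNormal d y x + δ * outerNormal d m x ≤ 1 := by
    rw [eventually_all_finite hP.1.finite_extremePoints]
    intro x hx
    by_cases h1 : outerNormal d y x = 1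
    · have : outerNormal d m x = 0 := hf (Submodule.subset_span ⟨hx, h1⟩)
      simp [h1, this]
    · have hlt := lt_of_le_of_ne (hP.mem_iff_le_one.1 hx.1 y hy) h1
      have hcont : Continuous fun δ : ℝ => outerNormal d y x + δ * outerNormal d m x := by
        fun_prop
      filter_upwards [hcont.tendsto' 0 (outerNormal d y x) (by simp) |>.eventually_lt_const hlt]
        with δ hδ using hδ.le
  obtain ⟨ε, hε, hball⟩ := Metric.eventually_nhds_iff.1 hev
  have hmem : ∀ δ : ℝ, |δ| < ε → y + δ • m ∈ dualPolytope P := by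
    intro δ hδ
    rw [hP.1.mem_dualPolytope_iff]
    intro x hx
    have := hball (y := δ) (by simpa using hδ) x hx
    simpa using this
  have h1 := hmem (ε / 2) (by rw [abs_of_pos (by positivity)]; linarith)
  have h2 := hmem (-(ε / 2)) (by rw [abs_neg, abs_of_pos (by positivity)]; linarith)
  have := hy.2 h1 h2 ⟨1 / 2, 1 / 2, by norm_num, by norm_num, by norm_num, by module⟩
  rw [add_eq_left, smul_eq_zero] at this
  rcases this with h | h
  · linarith
  · exact hm0 h

lemma mem_extremePoints_of_span (hP : IsReflexive P) {y : Fin d → ℝ} (hy : y ∈ dualPolytope P)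
    (hspan : Submodule.span ℝ {x ∈ extremePoints ℝ P | outerNormal d y x = 1} = ⊤) :
    y ∈ extremePoints ℝ (dualPolytope P) := by
  rw [mem_extremePoints_iff_left]
  refine ⟨hy, ?_⟩
  rintro y₁ hy₁ y₂ hy₂ ⟨a, b, ha, hb, hab, rfl⟩
  apply (outerNormal d).injective
  refine LinearMap.ext_on hspan ?_
  rintro x ⟨hx, hx1⟩
  have h1 := hP.1.mem_dualPolytope_iff.1 hy₁ x hx
  have h2 := hP.1.mem_dualPolytope_iff.1 hy₂ x hx
  rw [hx1]
  simp only [map_add, map_smul, LinearMap.add_apply, LinearMap.smul_apply, smul_eq_mul] at hx1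
  by_contra hne
  have h3 := lt_of_le_of_ne h1 hne
  nlinarith

lemma isFacet (hP : IsReflexive P) (hd : d ≠ 0) {y : Fin d → ℝ}
    (hy : y ∈ extremePoints ℝ (dualPolytope P)) :
    IsFacet P {x ∈ P | outerNormal d y x = 1} := by
  have hspan := hP.span_active_eq_top hy
  have : NeZero d := ⟨hd⟩
  have hne : {x ∈ extremePoints ℝ P | outerNormal d y x = 1}.Nonempty := by
    by_contra h
    rw [not_nonempty_iff_eq_empty.1 h, Submodule.span_empty] at hspan
    exact bot_ne_top hspan
  obtain ⟨b, hb, hb1⟩ := hne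
  have hdot : ∀ x, dotProd (-y) x = outerNormal d y x := fun x => by
    simp [outerNormal_apply, dotProd, mul_comm]
  refine ⟨⟨-y, 1, fun x hx => ?_, ?_⟩, ⟨b, hb.1, hb1⟩, ?_⟩
  · rw [hdot]
    exact hP.mem_iff_le_one.1 hx y hy
  · simp only [hdot]
  have hle : vectorSpan ℝ {x ∈ P | outerNormal d y x = 1} ≤ (outerNormal d y).ker := by
    rw [vectorSpan_def, Submodule.span_le]
    rintro _ ⟨x, ⟨-, hx⟩, x', ⟨-, hx'⟩, rfl⟩
    simp [hx, hx']
  have hlt : Module.finrank ℝ (vectorSpan ℝ {x ∈ P | outerNormal d y x = 1}) < d := by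
    have := Submodule.finrank_lt (s := vectorSpan ℝ {x ∈ P | outerNormal d y x = 1}) fun h => by
      have hbk := hle (h ▸ Submodule.mem_top : b ∈ _)
      rw [LinearMap.mem_ker, hb1] at hbk
      exact one_ne_zero hbk
    simpa using this
  have hsup : vectorSpan ℝ {x ∈ P | outerNormal d y x = 1} ⊔ Submodule.span ℝ {b} = ⊤ := by
    rw [eq_top_iff, ← hspan, Submodule.span_le]
    rintro x ⟨hx, hx1⟩
    have hxb : x - b ∈ vectorSpan ℝ {x ∈ P | outerNormal d y x = 1} :=
      vsub_mem_vectorSpan ℝ (p₁ := x) (p₂ := b) ⟨hx.1, hx1⟩ ⟨hb.1, hb1⟩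
    rw [← sub_add_cancel x b]
    exact Submodule.add_mem_sup hxb (Submodule.mem_span_singleton_self b)
  have hge := Submodule.finrank_add_le_finrank_add_finrank
    (vectorSpan ℝ {x ∈ P | outerNormal d y x = 1}) (Submodule.span ℝ {b})
  rw [hsup, finrank_top, Module.finrank_fin_fun] at hge
  have := finrank_span_singleton (K := ℝ) (v := b) (by rintro rfl; simp at hb1)
  omega

lemma extremePoints_facet (hP : IsReflexive P) {y : Fin d → ℝ}
    (hy : y ∈ extremePoints ℝ (dualPolytope P)) :
    extremePoints ℝ {x ∈ P | outerNormal d y x = 1} =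
      {x ∈ extremePoints ℝ P | outerNormal d y x = 1} := by
  have hext : IsExtreme ℝ P {x ∈ P | outerNormal d y x = 1} := by
    refine ⟨fun x hx => hx.1, ?_⟩
    rintro x hx x' hx' _ ⟨-, hz⟩ ⟨a, b, ha, hb, hab, rfl⟩
    refine ⟨hx, ?_⟩
    have h1 := hP.mem_iff_le_one.1 hx y hy
    have h2 := hP.mem_iff_le_one.1 hx' y hy
    simp only [map_add, map_smul, smul_eq_mul] at hz
    by_contra hne
    have h3 := lt_of_le_of_ne h1 hne
    nlinarith
  rw [hext.extremePoints_eq]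
  ext x
  constructor
  · rintro ⟨⟨-, h1⟩, h2⟩
    exact ⟨h2, h1⟩
  · rintro ⟨h2, h1⟩
    exact ⟨⟨h2.1, h1⟩, h2⟩

/-- Two points in a common facet lie in a common facet given by a vertex of the dual polytope. -/
lemma exists_outerNormal_of_sameFacet (hP : IsReflexive P) (hd : d ≠ 0) {v w : Fin d → ℝ}
    (h : SameFacet P v w) : ∃ y ∈ extremePoints ℝ (dualPolytope P),
      outerNormal d y v = 1 ∧ outerNormal d y w = 1 := by
  obtain ⟨_, ⟨⟨u, c, hle, rfl⟩, -, hrank⟩, ⟨hvP, hv⟩, ⟨hwP, hw⟩⟩ := h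
  have hdot : ∀ x, dotProd u x = outerNormal d (-u) x := fun x => by
    simp [outerNormal_apply, dotProd, mul_comm]
  simp only [hdot] at hle hv hw
  have hc0 : 0 ≤ c := by simpa using hle 0 (interior_subset hP.2.1)
  have hc : 0 < c := by
    refine lt_of_le_of_ne hc0 ?_
    rintro rfl
    have hzero := linearMap_eq_zero_of_nonpos hP.2.1 hle
    have hset : {x | x ∈ P ∧ dotProd u x = 0} = P := by
      ext x
      simp [hdot, hzero]
    have htop : affineSpan ℝ P = ⊤ :=
      hP.1.convex.interior_nonempty_iff_affineSpan_eq_top.1 ⟨0, hP.2.1⟩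
    rw [hset, ← direction_affineSpan, htop, AffineSubspace.direction_top, finrank_top,
      Module.finrank_fin_fun] at hrank
    omega
  set A : Set (Fin d → ℝ) :=
    {y ∈ dualPolytope P | outerNormal d y v = 1 ∧ outerNormal d y w = 1} with hA
  have hval : ∀ x, outerNormal d (c⁻¹ • -u) x = c⁻¹ * outerNormal d (-u) x := fun x => by
    rw [map_smul, LinearMap.smul_apply, smul_eq_mul]
  have hAne : A.Nonempty := by
    refine ⟨c⁻¹ • -u, mem_dualPolytope.2 fun x hx => ?_, ?_, ?_⟩
    · rw [hval, inv_mul_le_iff₀ hc, mul_one]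
      exact hle x hx
    · rw [hval, hv, inv_mul_cancel₀ hc.ne']
    · rw [hval, hw, inv_mul_cancel₀ hc.ne']
  have hcont : ∀ x, Continuous fun y => outerNormal d y x := fun x =>
    LinearMap.continuous_of_finiteDimensional
      ((LinearMap.applyₗ x).comp (outerNormal d).toLinearMap)
  have hAc : IsCompact A := hP.2.2.isCompact.inter_right
    ((isClosed_eq (hcont v) continuous_const).inter (isClosed_eq (hcont w) continuous_const))
  have hext : IsExtreme ℝ (dualPolytope P) A := by
    refine ⟨fun x hx => hx.1, ?_⟩
    rintro y hy y' hy' _ ⟨-, hz⟩ ⟨a, b, ha, hb, hab, rfl⟩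
    simp only [map_add, map_smul, LinearMap.add_apply, LinearMap.smul_apply, smul_eq_mul] at hz
    have key : ∀ x ∈ P, a * outerNormal d y x + b * outerNormal d y' x = 1 →
        outerNormal d y x = 1 := by
      intro x hx h
      have h1 := mem_dualPolytope.1 hy x hx
      have h2 := mem_dualPolytope.1 hy' x hx
      by_contra hne
      have h3 := lt_of_le_of_ne h1 hne
      nlinarith
    exact ⟨hy, key v hvP hz.1, key w hwP hz.2⟩
  obtain ⟨y, hy⟩ := hAc.extremePoints_nonempty hAne
  exact ⟨y, hext.extremePoints_subset_extremePoints hy, hy.1.2⟩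

end IsReflexive

namespace IsReflexive

lemma exists_adjacent (hP : IsReflexive P) {y e : Fin d → ℝ} {c : Module.Dual ℝ (Fin d → ℝ)}
    (hy : y ∈ extremePoints ℝ (dualPolytope P)) (hce : c e = 1)
    (hc : ∀ x ∈ extremePoints ℝ P, outerNormal d y x = 1 → x ≠ e → c x = 0) :
    ∃ y' ∈ extremePoints ℝ (dualPolytope P), ∃ t : ℝ, 0 < t ∧
      outerNormal d y' = outerNormal d y - t • c := by
  have hc0 : ∀ x ∈ extremePoints ℝ P, outerNormal d y x = 1 → 0 ≤ c x := by
    intro x hx h1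
    by_cases hxe : x = e
    · rw [hxe, hce]
      exact zero_le_one
    · exact (hc x hx h1 hxe).ge
  have hne : {x ∈ extremePoints ℝ P | c x < 0}.Nonempty := by
    by_contra h
    have hnn : ∀ x ∈ P, (-c) x ≤ 0 := by
      intro x hx
      rw [← hP.1.convexHull_extremePoints] at hx
      refine convexHull_min (t := {x | (-c) x ≤ 0}) (fun z hz => ?_)
        (convex_halfSpace_le (-c).isLinear 0) hx
      by_contra hlt
      exact h ⟨z, hz, by simpa using hlt⟩
    have := linearMap_eq_zero_of_nonpos hP.2.1 hnn
    rw [neg_eq_zero.1 this] at hce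
    exact zero_ne_one hce
  obtain ⟨q, ⟨hq, hcq⟩, hmin⟩ :=
    (hP.1.finite_extremePoints.subset (sep_subset _ _)).exists_minimalFor
      (fun x => (1 - outerNormal d y x) / -c x) _ hne
  set t := (1 - outerNormal d y q) / -c q with ht
  have hlt : outerNormal d y q < 1 := lt_of_le_of_ne (hP.mem_iff_le_one.1 hq.1 y hy)
    fun h => hcq.not_ge (hc0 q hq h)
  have ht0 : 0 < t := div_pos (sub_pos.2 hlt) (neg_pos.2 hcq)
  obtain ⟨y', hy'⟩ := (outerNormal d).surjective (outerNormal d y - t • c)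
  have hval : ∀ x, outerNormal d y' x = outerNormal d y x - t * c x := fun x => by
    rw [hy']
    rfl
  have hmem : y' ∈ dualPolytope P := by
    rw [hP.1.mem_dualPolytope_iff]
    intro x hx
    have h1 := hP.mem_iff_le_one.1 hx.1 y hy
    rw [hval]
    rcases lt_or_ge (c x) 0 with hcx | hcx
    · have h2 : t ≤ (1 - outerNormal d y x) / -c x := by
        by_contra h
        exact h (hmin ⟨hx, hcx⟩ (not_le.1 h).le)
      rw [le_div_iff₀ (neg_pos.2 hcx)] at h2
      linarith
    · nlinarith
  refine ⟨y', hP.mem_extremePoints_of_span hmem ?_, t, ht0, hy'⟩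
  set A := {x ∈ extremePoints ℝ P | outerNormal d y x = 1} with hA
  set A' := {x ∈ extremePoints ℝ P | outerNormal d y' x = 1}
  have hsub : Submodule.span ℝ (A \ {e}) ≤ Submodule.span ℝ A' := by
    refine Submodule.span_mono ?_
    rintro x ⟨⟨hx, hx1⟩, hxe⟩
    refine ⟨hx, ?_⟩
    rw [hval, hx1, hc x hx hx1 hxe, mul_zero, sub_zero]
  have hqA' : q ∈ Submodule.span ℝ A' := by
    refine Submodule.subset_span ⟨hq, ?_⟩
    rw [hval, ht, div_mul_eq_mul_div, div_neg, mul_div_assoc, div_self hcq.ne]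
    ring
  have hspan := hP.span_active_eq_top hy
  have hqs : q ∈ Submodule.span ℝ (insert e (A \ {e})) := by
    refine Submodule.span_mono (s := A) (fun x hx => ?_) (hspan ▸ Submodule.mem_top)
    by_cases hxe : x = e
    · exact Or.inl hxe
    · exact Or.inr ⟨hx, hxe⟩
  obtain ⟨a, z, hz, hqz⟩ := Submodule.mem_span_insert.1 hqs
  have hcz : c z = 0 := by
    have : Submodule.span ℝ (A \ {e}) ≤ c.ker :=
      Submodule.span_le.2 fun x hx => hc x hx.1.1 hx.1.2 hx.2
    exact this hz
  have ha : a ≠ 0 := by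
    rintro rfl
    rw [hqz, map_add, map_smul, hcz, zero_smul, add_zero] at hcq
    exact lt_irrefl _ hcq
  have heA' : e ∈ Submodule.span ℝ A' := by
    have : a • e ∈ Submodule.span ℝ A' := by
      rw [← add_sub_cancel_right (a • e) z, ← hqz]
      exact Submodule.sub_mem _ hqA' (hsub hz)
    exact (Submodule.smul_mem_iff _ ha).1 this
  rw [eq_top_iff, ← hspan, Submodule.span_le]
  intro x hx
  by_cases hxe : x = e
  · exact hxe ▸ heA'
  · exact hsub (Submodule.subset_span ⟨hx, hxe⟩)

lemma dim_ne_zero (hs : IsSimplicial P) {v : Fin d → ℝ}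
    (hv : v ∈ extremePoints ℝ P) : d ≠ 0 := by
  rintro rfl
  have h := hs P ⟨⟨0, 0, fun x _ => by simp [dotProd], by simp [dotProd]⟩, ⟨v, hv.1⟩,
    Module.finrank_zero_of_subsingleton⟩
  rw [Set.ncard_eq_zero (Set.toFinite _)] at h
  exact (h ▸ hv : v ∈ (∅ : Set _))

lemma ncard_active (hP : IsReflexive P) (hs : IsSimplicial P) (hd : d ≠ 0) {y : Fin d → ℝ}
    (hy : y ∈ extremePoints ℝ (dualPolytope P)) :
    {x ∈ extremePoints ℝ P | outerNormal d y x = 1}.ncard = d := by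
  rw [← hP.extremePoints_facet hy]
  exact hs _ (hP.isFacet hd hy)

lemma exists_coord (hP : IsReflexive P) (hs : IsSimplicial P) (hd : d ≠ 0) {y : Fin d → ℝ}
    (hy : y ∈ extremePoints ℝ (dualPolytope P)) {A : Finset (Fin d → ℝ)}
    (hA : (A : Set (Fin d → ℝ)) = {x ∈ extremePoints ℝ P | outerNormal d y x = 1}) :
    ∃ c : (Fin d → ℝ) → Module.Dual ℝ (Fin d → ℝ), (∀ x, ∑ e ∈ A, c e x • e = x) ∧
      (∀ e ∈ A, c e e = 1) ∧ ∀ e ∈ A, ∀ e' ∈ A, e ≠ e' → c e e' = 0 := by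
  classical
  have hcard : Fintype.card A = Module.finrank ℝ (Fin d → ℝ) := by
    rw [Fintype.card_coe, Module.finrank_fin_fun, ← Set.ncard_coe_finset, hA,
      hP.ncard_active hs hd hy]
  let b : Module.Basis A ℝ (Fin d → ℝ) :=
    basisOfTopLeSpanOfCardEqFinrank (fun e : A => (e : Fin d → ℝ))
    (by rw [Subtype.range_coe_subtype]; exact (hA ▸ hP.span_active_eq_top hy).ge) hcard
  have hb : ∀ e : A, b e = e := fun e => by simp [b]
  refine ⟨fun e => if h : e ∈ A then b.coord ⟨e, h⟩ else 0, fun x => ?_, fun e he => ?_,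
    fun e he e' he' hne => ?_⟩
  · rw [← Finset.sum_coe_sort]
    conv_rhs => rw [← b.sum_repr x]
    refine Finset.sum_congr rfl fun e _ => ?_
    simp [hb]
  · have := b.repr_self_apply ⟨e, he⟩ ⟨e, he⟩
    rw [hb] at this
    simpa [he] using this
  · have := b.repr_self_apply ⟨e', he'⟩ ⟨e, he⟩
    rw [hb] at this
    simpa [he, hne.symm] using this

/-- A simplicial reflexive polytope gives rise to a facet system. -/
lemma exists_facetSystem (hP : IsReflexive P) (hs : IsSimplicial P) (hd : d ≠ 0) :
    ∃ S : FacetSystem (Fin d → ℝ), S.verts = extremePoints ℝ P ∧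
      S.normals = outerNormal d '' extremePoints ℝ (dualPolytope P) := by
  have hfin : ∀ u : Module.Dual ℝ (Fin d → ℝ), {x ∈ extremePoints ℝ P | u x = 1}.Finite :=
    fun u => hP.1.finite_extremePoints.subset (sep_subset _ _)
  have hcoord : ∀ u ∈ outerNormal d '' extremePoints ℝ (dualPolytope P),
      ∃ c : (Fin d → ℝ) → Module.Dual ℝ (Fin d → ℝ),
        (∀ x, ∑ e ∈ (hfin u).toFinset, c e x • e = x) ∧
        (∀ e ∈ (hfin u).toFinset, c e e = 1) ∧
        ∀ e ∈ (hfin u).toFinset, ∀ e' ∈ (hfin u).toFinset, e ≠ e' → c e e' = 0 := by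
    rintro _ ⟨y, hy, rfl⟩
    exact hP.exists_coord hs hd hy (Set.Finite.coe_toFinset _)
  choose! coord hsum hself hne using hcoord
  have hmem : ∀ {u : Module.Dual ℝ (Fin d → ℝ)} {x},
      x ∈ (hfin u).toFinset ↔ x ∈ extremePoints ℝ P ∧ u x = 1 := fun {u x} => by
    rw [Set.Finite.mem_toFinset]
    rfl
  refine ⟨{ lattice := integerLattice d
            verts := extremePoints ℝ P
            normals := outerNormal d '' extremePoints ℝ (dualPolytope P)
            facet := fun u => (hfin u).toFinset
            coord := coord
            dim := d
            mem_facet := fun _ _ => hmem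
            verts_subset := hP.1.isLatticePoint
            ne_zero := ne_zero_of_mem_extremePoints hd hP.2.1
            integral := ?_
            le_one := ?_
            exists_eq_one := ?_
            card_facet := ?_
            sum_coord := fun hu => hsum _ hu
            coord_self := fun hu _ he => hself _ hu _ he
            coord_of_ne := fun hu _ he _ he' h => hne _ hu _ he _ he' h
            exists_adjacent := ?_ }, rfl, rfl⟩
  · rintro _ ⟨y, hy, rfl⟩ x hx
    exact hP.exists_outerNormal_eq_int hx hy
  · rintro _ ⟨y, hy, rfl⟩ x hx
    exact hP.mem_iff_le_one.1 hx.1 y hy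
  · intro x hx hx0 h
    obtain ⟨y, hy, h1⟩ := hP.exists_outerNormal_eq_one hx hx0
      (hP.mem_of_le_one fun y hy => h _ ⟨y, hy, rfl⟩)
    exact ⟨_, ⟨y, hy, rfl⟩, h1⟩
  · rintro _ ⟨y, hy, rfl⟩
    rw [← Set.ncard_eq_toFinset_card _ (hfin _)]
    exact hP.ncard_active hs hd hy
  · rintro _ ⟨y, hy, rfl⟩ e he
    have hu : outerNormal d y ∈ outerNormal d '' extremePoints ℝ (dualPolytope P) := ⟨y, hy, rfl⟩
    obtain ⟨y', hy', t, ht, h⟩ := hP.exists_adjacent hy (hself _ hu e he)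
      fun x hx hx1 hxe => hne _ hu e he x (hmem.2 ⟨hx, hx1⟩) hxe.symm
    exact ⟨_, ⟨y', hy', rfl⟩, t, ht, fun x => by rw [h]; rfl⟩

end IsReflexive

lemma continuous_projAlong (v : Fin d → ℝ) : Continuous (projAlong v) :=
  continuous_quot_mk

lemma projAlong_eq_iff {v x y : Fin d → ℝ} :
    projAlong v x = projAlong v y ↔ ∃ c : ℝ, x = y + c • v := by
  rw [projAlong, Submodule.mkQ_apply, Submodule.mkQ_apply, Submodule.Quotient.eq,
    Submodule.mem_span_singleton]
  refine exists_congr fun c => ?_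
  rw [eq_sub_iff_add_eq, add_comm, eq_comm]

lemma IsLatticePolytope.finite_quotLattice_inter_frontier (hP : IsLatticePolytope P)
    {v : Fin d → ℝ} (hv : IsLatticePoint v) :
    {q ∈ frontier (projAlong v '' P) | q ∈ quotLattice v}.Finite := by
  have : IsClosed (Submodule.span ℝ {v} : Set (Fin d → ℝ)) :=
    Submodule.closed_of_finiteDimensional _
  have hcl : IsClosed (projAlong v '' P) := (hP.isCompact.image (continuous_projAlong v)).isClosed
  have hbdd : Bornology.IsBounded ((fun a : (Fin d → ℝ) × ℝ => a.1 + a.2 • v) '' (P ×ˢ Icc 0 1)) :=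
    ((hP.isCompact.prod isCompact_Icc).image (by fun_prop)).isBounded
  refine (hbdd.finite_isLatticePoint.image (projAlong v)).subset ?_
  rintro _ ⟨hq, x, hx, rfl⟩
  obtain ⟨p, hp, hpx⟩ := hcl.frontier_subset hq
  obtain ⟨c, rfl⟩ := projAlong_eq_iff.1 hpx.symm
  refine ⟨p + Int.fract c • v, ⟨⟨(p, Int.fract c), ⟨hp, Int.fract_nonneg c,
    (Int.fract_lt_one c).le⟩, rfl⟩, ?_⟩, projAlong_eq_iff.2 ⟨-⌊c⌋, ?_⟩⟩
  · have := IsLatticePoint.add hx (hv.zsmul (-⌊c⌋))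
    convert this using 1
    rw [Int.fract]
    push_cast
    module
  · rw [Int.fract]
    module

lemma projAlong_mem_frontier {v e : Fin d → ℝ} (he : e ∈ P) {f : Module.Dual ℝ (Fin d → ℝ)}
    (hfv : f v = 0) (hfe : f e = 1) (hf : ∀ x ∈ P, f x ≤ 1) :
    projAlong v e ∈ frontier (projAlong v '' P) := by
  refine ⟨subset_closure ⟨e, he, rfl⟩, fun hi => ?_⟩
  have h : ∀ᶠ z in 𝓝 e, projAlong v z ∈ projAlong v '' P :=
    (continuous_projAlong v).continuousAt (mem_interior_iff_mem_nhds.1 hi)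
  have hcont : Tendsto (fun δ : ℝ => e + δ • e) (𝓝[>] 0) (𝓝 e) := by
    have : Continuous fun δ : ℝ => e + δ • e := by fun_prop
    exact (this.tendsto' 0 e (by simp)).mono_left nhdsWithin_le_nhds
  obtain ⟨δ, ⟨x, hx, hxe⟩, hδ⟩ := ((hcont.eventually h).and self_mem_nhdsWithin).exists
  obtain ⟨c, rfl⟩ := projAlong_eq_iff.1 hxe
  have h1 := hf _ hx
  simp only [map_add, map_smul, hfv, hfe, smul_eq_mul, mul_zero, add_zero, mul_one] at h1
  have : (0 : ℝ) < δ := hδ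
  linarith

namespace IsReflexive

lemma ncard_notMem_starSet (hP : IsReflexive P) (hs : IsSimplicial P) {v : Fin d → ℝ}
    (hv : v ∈ extremePoints ℝ P) :
    {w ∈ extremePoints ℝ P | w ∉ starSet P v}.ncard ≤ 3 ∧
      ({w ∈ extremePoints ℝ P | w ∉ starSet P v}.ncard = 3 → -v ∈ extremePoints ℝ P) := by
  have hd := dim_ne_zero hs hv
  obtain ⟨S, hSv, hSn⟩ := hP.exists_facetSystem hs hd
  have hcard := S.ncard_apart_le_two (hSv ▸ hv)
  set B := {w ∈ S.verts | S.Apart v w ∧ w ≠ -v} with hB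
  have hBfin : B.Finite := by
    rw [hB, hSv]
    exact hP.1.finite_extremePoints.subset (sep_subset _ _)
  have hsub : ∀ w ∈ extremePoints ℝ P, w ∉ starSet P v → w ≠ -v → w ∈ B := by
    refine fun w hw hws hwv => ⟨hSv ▸ hw, fun u hu huv huw => hws ?_, hwv⟩
    rw [hSn] at hu
    obtain ⟨y, hy, rfl⟩ := hu
    exact ⟨_, hP.isFacet hd hy, ⟨hv.1, huv⟩, hw.1, huw⟩
  constructor
  · refine (Set.ncard_le_ncard (t := insert (-v) B) (fun w hw => ?_) (hBfin.insert _)).trans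
      ((Set.ncard_insert_le _ _).trans (by omega))
    by_cases h : w = -v
    · exact Or.inl h
    · exact Or.inr (hsub w hw.1 hw.2 h)
  · intro h3
    by_contra hnv
    have := Set.ncard_le_ncard (s := {w ∈ extremePoints ℝ P | w ∉ starSet P v}) (t := B)
      (fun w hw => hsub w hw.1 hw.2 fun h => hnv (h ▸ hw.1)) hBfin
    omega

lemma ncard_starSet_le (hP : IsReflexive P) (hs : IsSimplicial P) {v : Fin d → ℝ}
    (hv : v ∈ extremePoints ℝ P) :
    {w ∈ extremePoints ℝ P | w ∈ starSet P v ∧ w ≠ v}.ncard ≤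
      {q ∈ frontier (projAlong v '' P) | q ∈ quotLattice v}.ncard := by
  have hd := dim_ne_zero hs hv
  refine Set.ncard_le_ncard_of_injOn (projAlong v) ?_ ?_
    (hP.1.finite_quotLattice_inter_frontier (hP.1.isLatticePoint hv))
  · rintro e ⟨he, hes, hev⟩
    obtain ⟨S, hSv, hSn⟩ := hP.exists_facetSystem hs hd
    obtain ⟨y, hy, hyv, hye⟩ := hP.exists_outerNormal_of_sameFacet hd hes
    have hu : outerNormal d y ∈ S.normals := hSn ▸ ⟨y, hy, rfl⟩
    obtain ⟨f, hfv, hfe, hf⟩ := S.exists_supporting_functional hu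
      ((S.mem_facet hu).2 ⟨hSv ▸ hv, hyv⟩) ((S.mem_facet hu).2 ⟨hSv ▸ he, hye⟩) hev
    refine ⟨projAlong_mem_frontier he.1 hfv hfe fun x hx => hf x ?_,
      e, hP.1.isLatticePoint he, rfl⟩
    rw [hSn]
    rintro _ ⟨y', hy', rfl⟩
    exact hP.mem_iff_le_one.1 hx y' hy'
  · have key : ∀ e₁ e₂ : Fin d → ℝ, e₁ ∈ P → e₂ ∈ starSet P v → ∀ c : ℝ, e₁ = e₂ + c • v →
        c ≤ 0 := by
      rintro _ e₂ he₁ hs₂ c rfl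
      obtain ⟨y, hy, hyv, hye⟩ := hP.exists_outerNormal_of_sameFacet hd hs₂
      have := hP.mem_iff_le_one.1 he₁ y hy
      rw [map_add, map_smul, hyv, hye, smul_eq_mul, mul_one] at this
      linarith
    rintro e₁ ⟨he₁, hs₁, -⟩ e₂ ⟨he₂, hs₂, -⟩ h
    obtain ⟨c, hc⟩ := projAlong_eq_iff.1 h
    have h1 := key e₁ e₂ he₁.1 hs₂ c hc
    have h2 := key e₂ e₁ he₂.1 hs₁ (-c) (by rw [hc]; module)
    rw [hc, le_antisymm h1 (by linarith), zero_smul, add_zero]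

lemma ncard_extremePoints_le (hP : IsReflexive P) (hs : IsSimplicial P) {v : Fin d → ℝ}
    (hv : v ∈ extremePoints ℝ P) :
    (extremePoints ℝ P).ncard ≤ {q ∈ frontier (projAlong v '' P) | q ∈ quotLattice v}.ncard + 1 +
      {w ∈ extremePoints ℝ P | w ∉ starSet P v}.ncard := by
  have hfin := hP.1.finite_extremePoints
  have hsub : extremePoints ℝ P ⊆
      insert v {w ∈ extremePoints ℝ P | w ∈ starSet P v ∧ w ≠ v} ∪
        {w ∈ extremePoints ℝ P | w ∉ starSet P v} := by
    intro w hw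
    by_cases h : w ∈ starSet P v
    · by_cases hwv : w = v
      · exact Or.inl (Or.inl hwv)
      · exact Or.inl (Or.inr ⟨hw, h, hwv⟩)
    · exact Or.inr ⟨hw, h⟩
  have h1 := Set.ncard_le_ncard hsub (((hfin.subset (sep_subset _ _)).insert _).union
    (hfin.subset (sep_subset _ _)))
  have h2 := Set.ncard_union_le (insert v {w ∈ extremePoints ℝ P | w ∈ starSet P v ∧ w ≠ v})
    {w ∈ extremePoints ℝ P | w ∉ starSet P v}
  have h3 := Set.ncard_insert_le v {w ∈ extremePoints ℝ P | w ∈ starSet P v ∧ w ≠ v}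
  have h4 := hP.ncard_starSet_le hs hv
  omega

end IsReflexive

end Polytope

/-- For a simplicial reflexive polytope `P` and a vertex `v`, at most three
vertices of `P` lie outside the star set of `v` (equality forcing `-v` to be a vertex), and
`|V(P)| ≤ |∂P_v ∩ (ℤ^d/ℤv)| + 4`, with equality again forcing `-v` to be a vertex. -/
theorem casagrande_type_bound {d : ℕ} (P : Set (Fin d → ℝ)) (hP : IsReflexive P)
    (hs : IsSimplicial P) (v : Fin d → ℝ) (hv : v ∈ Set.extremePoints ℝ P) :
    {w ∈ Set.extremePoints ℝ P | w ∉ starSet P v}.ncard ≤ 3 ∧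
    ({w ∈ Set.extremePoints ℝ P | w ∉ starSet P v}.ncard = 3 →
      -v ∈ Set.extremePoints ℝ P) ∧
    (Set.extremePoints ℝ P).ncard ≤
      {q ∈ frontier (projAlong v '' P) | q ∈ quotLattice v}.ncard + 4 ∧
    ((Set.extremePoints ℝ P).ncard =
        {q ∈ frontier (projAlong v '' P) | q ∈ quotLattice v}.ncard + 4 →
      -v ∈ Set.extremePoints ℝ P) := by
  obtain ⟨h1, h2⟩ := hP.ncard_notMem_starSet hs hv
  have h3 := hP.ncard_extremePoints_le hs hv
  exact ⟨h1, h2, by omega, fun h => h2 (by omega)⟩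

end
end
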